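/- arXiv:1006.0122 — 2 statements merged into one kernel-verified Lean document; each statement's English description precedes it below -/
import Mathlib

section
/- Let r > 1/2, α > −1, and define g(x) = |D|^α(⟨·⟩^{−2r})(x), i.e. the tempered distribution whose Fourier transform is |ξ|^α ĥ(ξ) where ĥ is the Fourier transform of ⟨x⟩^{−2r}. Then g is a continuous function and there exists C > 0 such that |g(x)| ≤ C ⟨x⟩^{−(α+1)} for all x ∈ ℝ. -/
open MeasureTheory Complex ComplexConjugate

noncomputable section

/-- Japanese bracket `⟨x⟩ = (1+x²)^{1/2}`. -/
def jap (x : ℝ) : ℝ := Real.sqrt (1 + x ^ 2)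

/-- Fourier transform with the convention `û(ξ) = ∫ e^{-ixξ} u(x) dx`. -/
def FT (u : ℝ → ℂ) (ξ : ℝ) : ℂ := ∫ x : ℝ, Complex.exp (-(Complex.I * (x : ℂ) * (ξ : ℂ))) * u x

/-- Inverse Fourier transform `(1/2π) ∫ e^{ixξ} v(ξ) dξ`. -/
def FTinv (v : ℝ → ℂ) (x : ℝ) : ℂ :=
  ((2 * Real.pi)⁻¹ : ℝ) • ∫ ξ : ℝ, Complex.exp (Complex.I * (x : ℂ) * (ξ : ℂ)) * v ξ

/-- The Fourier multiplier `|D|^α` with symbol `|ξ|^α`. -/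
def fracD (α : ℝ) (u : ℝ → ℂ) : ℝ → ℂ :=
  FTinv (fun ξ => ((|ξ| ^ α : ℝ) : ℂ) * FT u ξ)

end

section HalfLine

open Set Filter Topology

lemma norm_cexp_I_mul_mul (y η : ℝ) : ‖cexp (I * y * η)‖ = 1 := by
  rw [show I * (y : ℂ) * η = ((y * η : ℝ) : ℂ) * I by push_cast; ring, norm_exp_ofReal_mul_I]

/-- The half-line Fourier integral of an integrable nonnegative decreasing function is controlled
by the mass of the function over one half-period of the oscillation. -/
lemma norm_integral_cexp_mul_le_of_antitoneOn {H : ℝ → ℝ} (hint : IntegrableOn H (Ioi 0))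
    (hanti : AntitoneOn H (Ioi 0)) (hnn : ∀ η ∈ Ioi (0 : ℝ), 0 ≤ H η) {y : ℝ} (hy : 0 < y) :
    ‖∫ η in Ioi (0 : ℝ), cexp (I * y * η) * (H η : ℂ)‖ ≤ ∫ η in Ioc 0 (Real.pi / y), H η := by
  set δ := Real.pi / y with hδ
  have hδ0 : 0 < δ := by positivity
  set K : ℝ → ℝ := (Ioi (0 : ℝ)).indicator H with hK
  have hKint : Integrable K := hint.integrable_indicator measurableSet_Ioi
  have hKδ : Integrable fun η => K (η - δ) := hKint.comp_sub_right δ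
  have e_int {G : ℝ → ℝ} (hG : Integrable G) :
      Integrable fun η : ℝ => cexp (I * y * η) * (G η : ℂ) :=
    hG.ofReal.bdd_mul (c := 1) (by fun_prop) (ae_of_all _ fun η => (norm_cexp_I_mul_mul y η).le)
  have e_shift (η : ℝ) : cexp (I * y * ((η + δ : ℝ) : ℂ)) = -cexp (I * y * η) := by
    have : I * (y : ℂ) * ((η + δ : ℝ) : ℂ) = I * y * η + Real.pi * I := by
      have : (y : ℂ) ≠ 0 := by exact_mod_cast hy.ne'
      rw [hδ]; push_cast; field_simp
    rw [this, exp_add, exp_pi_mul_I, mul_neg_one]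
  have hA : ∫ η in Ioi (0 : ℝ), cexp (I * y * η) * (H η : ℂ)
      = ∫ η : ℝ, cexp (I * y * η) * (K η : ℂ) := by
    rw [← integral_indicator measurableSet_Ioi]
    congr 1 with η
    by_cases h : η ∈ Ioi (0 : ℝ) <;> simp [hK, h]
  have hB : ∫ η : ℝ, cexp (I * y * η) * (K (η - δ) : ℂ)
      = -∫ η : ℝ, cexp (I * y * η) * (K η : ℂ) := by
    rw [← integral_neg,
      ← integral_sub_right_eq_self (fun η : ℝ => -(cexp (I * y * η) * (K η : ℂ))) δ]
    congr 1 with η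
    have := e_shift (η - δ)
    rw [sub_add_cancel] at this
    rw [this]; ring
  have h2 : 2 * ∫ η : ℝ, cexp (I * y * η) * (K η : ℂ)
      = ∫ η : ℝ, (cexp (I * y * η) * (K η : ℂ) - cexp (I * y * η) * (K (η - δ) : ℂ)) := by
    rw [integral_sub (e_int hKint) (e_int hKδ), hB]; ring
  have hioc : IntegrableOn H (Ioc 0 δ) := hint.mono_set Ioc_subset_Ioi_self
  have hI : Integrable ((Ioc 0 δ).indicator H) := hioc.integrable_indicator measurableSet_Ioc
  have hle : ‖2 * ∫ η : ℝ, cexp (I * y * η) * (K η : ℂ)‖ ≤ 2 * ∫ η in Ioc 0 δ, H η := by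
    rw [h2]
    calc _ ≤ ∫ η : ℝ, (K (η - δ) - K η + 2 * (Ioc 0 δ).indicator H η) := by
          refine norm_integral_le_of_norm_le ((hKδ.sub hKint).add (hI.const_mul 2))
            (ae_of_all _ fun η => ?_)
          rw [← mul_sub, norm_mul, norm_cexp_I_mul_mul, one_mul, ← ofReal_sub, norm_real,
            Real.norm_eq_abs]
          rcases le_or_gt η 0 with h | h
          · have : ¬ δ < η := by linarith
            simp [hK, h.not_gt, this]
          · rcases le_or_gt η δ with h' | h'
            · have := hnn η h
              simp [hK, h, h', h'.not_gt, abs_of_nonneg this]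
              linarith
            · have := hanti (sub_pos.2 h') h (by linarith : η - δ ≤ η)
              simp only [hK, mem_Ioi, h, h', sub_pos, indicator_of_mem, mem_Ioc, h'.not_ge,
                and_false, not_false_eq_true, indicator_of_notMem, mul_zero, add_zero]
              rw [abs_sub_comm, abs_of_nonneg (by linarith)]
      _ = 2 * ∫ η in Ioc 0 δ, H η := by
          rw [integral_add (by exact hKδ.sub hKint) (hI.const_mul 2), integral_sub hKδ hKint,
            integral_sub_right_eq_self K, sub_self, zero_add, integral_const_mul,
            integral_indicator measurableSet_Ioc]
  rw [norm_mul, norm_ofNat] at hle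
  rw [hA]
  linarith

/-- The half-line Fourier integral of the Gaussian with a power weight. -/
noncomputable def halfGaussFT (a y : ℝ) : ℂ :=
  ∫ η in Ioi (0 : ℝ), cexp (I * y * η) * ((η ^ a * Real.exp (-(1 / 4) * η ^ 2) : ℝ) : ℂ)

lemma integrableOn_rpow_mul_gauss {a : ℝ} (ha : -1 < a) :
    IntegrableOn (fun η : ℝ => η ^ a * Real.exp (-(1 / 4) * η ^ 2)) (Ioi 0) :=
  integrableOn_rpow_mul_exp_neg_mul_sq (by norm_num) ha

lemma integrableOn_cexp_mul_rpow_mul_gauss {a : ℝ} (ha : -1 < a) (y : ℝ) :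
    IntegrableOn (fun η : ℝ => cexp (I * y * η) *
      ((η ^ a * Real.exp (-(1 / 4) * η ^ 2) : ℝ) : ℂ)) (Ioi 0) :=
  (integrableOn_rpow_mul_gauss ha).ofReal.bdd_mul (c := 1) (by fun_prop)
    (ae_of_all _ fun η => (norm_cexp_I_mul_mul y η).le)

lemma exists_norm_halfGaussFT_le (a : ℝ) : ∃ C, 0 ≤ C ∧ ∀ y, ‖halfGaussFT a y‖ ≤ C := by
  refine ⟨∫ η in Ioi (0 : ℝ), ‖η ^ a * Real.exp (-(1 / 4) * η ^ 2)‖, by positivity, fun y => ?_⟩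
  refine (norm_integral_le_integral_norm _).trans_eq ?_
  simp only [norm_mul, norm_cexp_I_mul_mul, one_mul, norm_real]

lemma halfGaussFT_neg (a y : ℝ) : halfGaussFT a (-y) = conj (halfGaussFT a y) := by
  rw [halfGaussFT, halfGaussFT, ← integral_conj]
  congr 1 with η
  simp only [map_mul, conj_ofReal, ← exp_conj, conj_I, ofReal_neg]
  ring_nf

lemma I_mul_halfGaussFT {a : ℝ} (ha : 0 < a) (y : ℝ) :
    I * y * halfGaussFT a y = -(a * halfGaussFT (a - 1) y) + 1 / 2 * halfGaussFT (a + 1) y := by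
  set w : ℝ → ℝ → ℂ := fun b η => cexp (I * y * η) *
    ((η ^ b * Real.exp (-(1 / 4) * η ^ 2) : ℝ) : ℂ) with hw
  have hi (b : ℝ) (hb : -1 < b) : IntegrableOn (w b) (Ioi 0) :=
    integrableOn_cexp_mul_rpow_mul_gauss hb y
  have hd : ∀ η ∈ Ioi (0 : ℝ), HasDerivAt (w a)
      (I * y * w a η + (a * w (a - 1) η - 1 / 2 * w (a + 1) η)) η := by
    intro η hη
    have hη : 0 < η := hη
    have h1 : HasDerivAt (fun η : ℝ => cexp (I * y * η)) (cexp (I * y * η) * (I * y)) η := by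
      simpa using (((hasDerivAt_id (η : ℂ)).const_mul (I * (y : ℂ))).cexp).comp_ofReal
    have h2 : HasDerivAt (fun η : ℝ => η ^ a) (a * η ^ (a - 1)) η :=
      Real.hasDerivAt_rpow_const (Or.inl hη.ne')
    have h3 : HasDerivAt (fun η : ℝ => Real.exp (-(1 / 4) * η ^ 2))
        (Real.exp (-(1 / 4) * η ^ 2) * (-(1 / 4) * (2 * η))) η := by
      simpa using ((hasDerivAt_pow 2 η).const_mul (-(1 / 4) : ℝ)).exp
    have h4 := h1.mul (h2.mul h3).ofReal_comp
    convert! h4 using 1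
    simp only [hw, Real.rpow_add_one hη.ne' a]
    push_cast
    simp only [Pi.mul_apply]
    push_cast
    ring
  have hi₁ : IntegrableOn (fun η => a * w (a - 1) η) (Ioi 0) := (hi _ (by linarith)).const_mul _
  have hi₂ : IntegrableOn (fun η => 1 / 2 * w (a + 1) η) (Ioi 0) :=
    (hi _ (by linarith)).const_mul _
  have hfi₂ : IntegrableOn (fun η => a * w (a - 1) η - 1 / 2 * w (a + 1) η) (Ioi 0) := hi₁.sub hi₂
  have hfi : IntegrableOn (fun η => I * y * w a η + (a * w (a - 1) η - 1 / 2 * w (a + 1) η))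
      (Ioi 0) := ((hi a (by linarith)).const_mul _).add hfi₂
  have hc : ContinuousWithinAt (w a) (Ici 0) 0 := by
    have : Continuous (w a) := by
      have := Real.continuous_rpow_const ha.le
      fun_prop
    exact this.continuousWithinAt
  have h := integral_Ioi_of_hasDerivAt_of_tendsto hc hd hfi
    (tendsto_zero_of_hasDerivAt_of_integrableOn_Ioi hd hfi (hi a (by linarith)))
  have h0 : w a 0 = 0 := by simp [hw, Real.zero_rpow ha.ne']
  have hsplit : ∫ η in Ioi (0 : ℝ), (I * y * w a η + (a * w (a - 1) η - 1 / 2 * w (a + 1) η))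
      = I * y * halfGaussFT a y + (a * halfGaussFT (a - 1) y - 1 / 2 * halfGaussFT (a + 1) y) := by
    rw [integral_add ((hi a (by linarith)).const_mul _) hfi₂, integral_sub hi₁ hi₂,
      integral_const_mul, integral_const_mul, integral_const_mul]
    rfl
  rw [hsplit, h0, sub_zero] at h
  linear_combination h

lemma exists_norm_halfGaussFT_le_of_nonpos {a : ℝ} (ha : -1 < a) (ha' : a ≤ 0) :
    ∃ C, 0 ≤ C ∧ ∀ y, 0 < y → ‖halfGaussFT a y‖ ≤ C * y ^ (-(a + 1)) := by
  refine ⟨Real.pi ^ (a + 1) / (a + 1), div_nonneg (by positivity) (by linarith), fun y hy => ?_⟩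
  have hanti : AntitoneOn (fun η : ℝ => η ^ a * Real.exp (-(1 / 4) * η ^ 2)) (Ioi 0) := by
    intro s hs t ht hst
    have hs : 0 < s := hs
    have ht : 0 < t := ht
    refine mul_le_mul (Real.rpow_le_rpow_of_nonpos hs hst ha') ?_ (by positivity) (by positivity)
    rw [Real.exp_le_exp]
    nlinarith
  have hpi : 0 ≤ Real.pi / y := by positivity
  have hrp : IntegrableOn (fun η : ℝ => η ^ a) (Ioc 0 (Real.pi / y)) :=
    (intervalIntegrable_iff_integrableOn_Ioc_of_le hpi).1
      (intervalIntegral.intervalIntegrable_rpow' ha)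
  calc ‖halfGaussFT a y‖
      ≤ ∫ η in Ioc 0 (Real.pi / y), η ^ a * Real.exp (-(1 / 4) * η ^ 2) :=
        norm_integral_cexp_mul_le_of_antitoneOn (integrableOn_rpow_mul_gauss ha) hanti
          (fun η hη => mul_nonneg (Real.rpow_nonneg (le_of_lt hη) _) (Real.exp_nonneg _)) hy
    _ ≤ ∫ η in Ioc 0 (Real.pi / y), η ^ a := by
        refine setIntegral_mono_on ((integrableOn_rpow_mul_gauss ha).mono_set Ioc_subset_Ioi_self)
          hrp measurableSet_Ioc fun η hη => ?_
        refine mul_le_of_le_one_right (Real.rpow_nonneg hη.1.le _) (Real.exp_le_one_iff.2 ?_)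
        nlinarith [sq_nonneg η]
    _ = Real.pi ^ (a + 1) / (a + 1) * y ^ (-(a + 1)) := by
        rw [← intervalIntegral.integral_of_le hpi, integral_rpow (Or.inl ha),
          Real.zero_rpow (by linarith), Real.div_rpow Real.pi_pos.le hy.le, Real.rpow_neg hy.le]
        ring

lemma exists_norm_halfGaussFT_le_mul_rpow_of_le (n : ℕ) {s : ℝ} (hs : 0 < s) (hsn : s ≤ n + 1) :
    ∀ a, s - 1 ≤ a → ∃ C, 0 ≤ C ∧ ∀ y, 1 ≤ y → ‖halfGaussFT a y‖ ≤ C * y ^ (-s) := by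
  have step {t a : ℝ} (ha : 0 < a)
      (h1 : ∃ C, 0 ≤ C ∧ ∀ y, 1 ≤ y → ‖halfGaussFT (a - 1) y‖ ≤ C * y ^ (-t))
      (h2 : ∃ C, 0 ≤ C ∧ ∀ y, 1 ≤ y → ‖halfGaussFT (a + 1) y‖ ≤ C * y ^ (-t)) :
      ∃ C, 0 ≤ C ∧ ∀ y, 1 ≤ y → ‖halfGaussFT a y‖ ≤ C * y ^ (-(t + 1)) := by
    obtain ⟨C₁, hC₁, h1⟩ := h1
    obtain ⟨C₂, hC₂, h2⟩ := h2
    refine ⟨a * C₁ + 1 / 2 * C₂, by positivity, fun y hy => ?_⟩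
    have hy0 : 0 < y := by linarith
    have h := congrArg norm (I_mul_halfGaussFT ha y)
    rw [norm_mul, norm_mul, norm_I, one_mul, norm_real, Real.norm_of_nonneg hy0.le] at h
    have h3 : y * ‖halfGaussFT a y‖ ≤ (a * C₁ + 1 / 2 * C₂) * y ^ (-t) := by
      rw [h]
      refine (norm_add_le _ _).trans ?_
      rw [norm_neg, norm_mul, norm_mul, norm_real, Real.norm_of_nonneg ha.le]
      have := mul_le_mul_of_nonneg_left (h1 y hy) ha.le
      have := h2 y hy
      norm_num
      linarith
    rw [neg_add, ← sub_eq_add_neg, Real.rpow_sub_one hy0.ne', ← mul_div_assoc, le_div_iff₀ hy0]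
    linarith
  have bdd (a : ℝ) : ∃ C, 0 ≤ C ∧ ∀ y : ℝ, 1 ≤ y → ‖halfGaussFT a y‖ ≤ C * y ^ (-(0 : ℝ)) := by
    obtain ⟨C, hC, h⟩ := exists_norm_halfGaussFT_le a
    exact ⟨C, hC, fun y _ => by simpa using h y⟩
  have mono {t u a : ℝ} (htu : t ≤ u)
      (h : ∃ C, 0 ≤ C ∧ ∀ y, 1 ≤ y → ‖halfGaussFT a y‖ ≤ C * y ^ (-u)) :
      ∃ C, 0 ≤ C ∧ ∀ y, 1 ≤ y → ‖halfGaussFT a y‖ ≤ C * y ^ (-t) := by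
    obtain ⟨C, hC, h⟩ := h
    refine ⟨C, hC, fun y hy => (h y hy).trans ?_⟩
    gcongr
  have base {a : ℝ} (ha : -1 < a) (ha' : a ≤ 0) :
      ∃ C, 0 ≤ C ∧ ∀ y, 1 ≤ y → ‖halfGaussFT a y‖ ≤ C * y ^ (-(a + 1)) := by
    obtain ⟨C, hC, h⟩ := exists_norm_halfGaussFT_le_of_nonpos ha ha'
    exact ⟨C, hC, fun y hy => h y (by linarith)⟩
  induction n generalizing s with
  | zero =>
    intro a ha
    rcases le_or_gt a 0 with ha' | ha'
    · exact mono (by linarith) (base (by linarith) ha')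
    · refine mono (u := 0 + 1) (by simpa using hsn) (step ha' (bdd _) (bdd _))
  | succ n ih =>
    intro a ha
    rcases le_or_gt s 1 with h | h
    · exact ih hs (by have : (0 : ℝ) ≤ n := n.cast_nonneg
                      linarith) a ha
    · have hsn' : s - 1 ≤ n + 1 := by push_cast at hsn; linarith
      have := step (t := s - 1) (a := a) (by linarith) (ih (by linarith) hsn' _ (by linarith))
        (ih (by linarith) hsn' _ (by linarith))
      rwa [sub_add_cancel] at this

lemma exists_norm_halfGaussFT_le_mul_rpow {a : ℝ} (ha : -1 < a) :
    ∃ C, 0 ≤ C ∧ ∀ y, y ≠ 0 → ‖halfGaussFT a y‖ ≤ C * |y| ^ (-(a + 1)) := by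
  obtain ⟨C₀, hC₀, h₀⟩ := exists_norm_halfGaussFT_le a
  obtain ⟨n, hn⟩ := exists_nat_ge a
  obtain ⟨C₁, hC₁, h₁⟩ := exists_norm_halfGaussFT_le_mul_rpow_of_le n (s := a + 1) (by linarith)
    (by linarith) a (by linarith)
  have pos (y : ℝ) (hy : 0 < y) : ‖halfGaussFT a y‖ ≤ (C₀ + C₁) * y ^ (-(a + 1)) := by
    have hp : 0 ≤ y ^ (-(a + 1)) := Real.rpow_nonneg hy.le _
    rcases le_or_gt 1 y with h | h
    · nlinarith [h₁ y h, mul_nonneg hC₀ hp]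
    · have := Real.one_le_rpow_of_pos_of_le_one_of_nonpos hy h.le (by linarith : -(a + 1) ≤ 0)
      nlinarith [h₀ y, mul_nonneg hC₁ hp]
  refine ⟨C₀ + C₁, by positivity, fun y hy => ?_⟩
  rcases hy.lt_or_gt with h | h
  · rw [abs_of_neg h, ← RCLike.norm_conj, ← halfGaussFT_neg]
    exact pos _ (by linarith)
  · rw [abs_of_pos h]
    exact pos _ h

end HalfLine

section Subordination

open Set Filter Topology

lemma integrable_abs_rpow_mul_exp_neg_mul_sq {a b : ℝ} (ha : -1 < a) (hb : 0 < b) :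
    Integrable fun η : ℝ => |η| ^ a * Real.exp (-b * η ^ 2) := by
  have hIoi : IntegrableOn (fun η : ℝ => |η| ^ a * Real.exp (-b * η ^ 2)) (Ioi 0) := by
    refine (integrableOn_rpow_mul_exp_neg_mul_sq hb ha).congr_fun (fun η hη => ?_) measurableSet_Ioi
    simp only [abs_of_pos (mem_Ioi.1 hη)]
  have hIic : IntegrableOn (fun η : ℝ => |η| ^ a * Real.exp (-b * η ^ 2)) (Iic 0) := by
    rw [integrableOn_Iic_iff_integrableOn_Iio]
    have : IntegrableOn (fun η : ℝ => |-η| ^ a * Real.exp (-b * (-η) ^ 2)) (Iio 0) :=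
      IntegrableOn.comp_neg_Iio (f := fun η : ℝ => |η| ^ a * Real.exp (-b * η ^ 2))
        (by simpa using hIoi)
    simpa only [abs_neg, even_two.neg_pow] using this
  rw [← integrableOn_univ, ← Iic_union_Ioi (a := (0 : ℝ))]
  exact hIic.union hIoi

/-- The Fourier integral of the Gaussian with an even power weight. -/
noncomputable def gaussFT (a y : ℝ) : ℂ :=
  ∫ η : ℝ, cexp (I * y * η) * ((|η| ^ a * Real.exp (-(1 / 4) * η ^ 2) : ℝ) : ℂ)

lemma gaussFT_eq {a : ℝ} (ha : -1 < a) (y : ℝ) :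
    gaussFT a y = halfGaussFT a (-y) + halfGaussFT a y := by
  have hint : Integrable fun η : ℝ => cexp (I * y * η) *
      ((|η| ^ a * Real.exp (-(1 / 4) * η ^ 2) : ℝ) : ℂ) :=
    (integrable_abs_rpow_mul_exp_neg_mul_sq ha (by norm_num)).ofReal.bdd_mul (c := 1) (by fun_prop)
      (ae_of_all _ fun η => (norm_cexp_I_mul_mul y η).le)
  rw [gaussFT, ← intervalIntegral.integral_Iic_add_Ioi (b := 0) hint.integrableOn hint.integrableOn]
  congr 1
  · have := integral_comp_neg_Ioi 0 fun η : ℝ => cexp (I * y * η) *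
      ((|η| ^ a * Real.exp (-(1 / 4) * η ^ 2) : ℝ) : ℂ)
    rw [neg_zero] at this
    rw [← this]
    refine setIntegral_congr_fun measurableSet_Ioi fun η hη => ?_
    simp [abs_of_pos (mem_Ioi.1 hη)]
  · refine setIntegral_congr_fun measurableSet_Ioi fun η hη => ?_
    simp [abs_of_pos (mem_Ioi.1 hη)]

lemma exists_norm_gaussFT_le {a : ℝ} (ha : -1 < a) : ∃ C, 0 ≤ C ∧ ∀ y, ‖gaussFT a y‖ ≤ C := by
  obtain ⟨C, hC, h⟩ := exists_norm_halfGaussFT_le a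
  refine ⟨C + C, by positivity, fun y => ?_⟩
  rw [gaussFT_eq ha]
  exact (norm_add_le _ _).trans (add_le_add (h _) (h _))

lemma exists_norm_gaussFT_le_mul_rpow {a : ℝ} (ha : -1 < a) :
    ∃ C, 0 ≤ C ∧ ∀ y, y ≠ 0 → ‖gaussFT a y‖ ≤ C * |y| ^ (-(a + 1)) := by
  obtain ⟨C, hC, h⟩ := exists_norm_halfGaussFT_le_mul_rpow ha
  refine ⟨C + C, by positivity, fun y hy => ?_⟩
  rw [gaussFT_eq ha, add_mul]
  refine (norm_add_le _ _).trans (add_le_add ?_ (h y hy))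
  simpa using h (-y) (neg_ne_zero.2 hy)

lemma abs_rpow_mul_exp_comp_mul_left (a : ℝ) {s : ℝ} (hs : 0 < s) (η : ℝ) :
    |s * η| ^ a * Real.exp (-(1 / (4 * s ^ 2)) * (s * η) ^ 2)
      = s ^ a * (|η| ^ a * Real.exp (-(1 / 4) * η ^ 2)) := by
  rw [abs_mul, abs_of_pos hs, Real.mul_rpow hs.le (abs_nonneg η), mul_assoc,
    show -(1 / (4 * s ^ 2)) * (s * η) ^ 2 = -(1 / 4) * η ^ 2 by field_simp]

lemma integral_cexp_mul_abs_rpow_mul_exp (a x : ℝ) {s : ℝ} (hs : 0 < s) :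
    ∫ ξ : ℝ, cexp (I * x * ξ) * ((|ξ| ^ a * Real.exp (-(1 / (4 * s ^ 2)) * ξ ^ 2) : ℝ) : ℂ)
      = ((s ^ (a + 1) : ℝ) : ℂ) * gaussFT a (x * s) := by
  have h := Measure.integral_comp_mul_left (fun ξ : ℝ => cexp (I * x * ξ) *
    ((|ξ| ^ a * Real.exp (-(1 / (4 * s ^ 2)) * ξ ^ 2) : ℝ) : ℂ)) s
  simp only [abs_rpow_mul_exp_comp_mul_left a hs] at h
  have h' : ∫ η : ℝ, cexp (I * x * ((s * η : ℝ) : ℂ)) *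
      ((s ^ a * (|η| ^ a * Real.exp (-(1 / 4) * η ^ 2)) : ℝ) : ℂ)
      = ((s ^ a : ℝ) : ℂ) * gaussFT a (x * s) := by
    rw [gaussFT, ← integral_const_mul]
    congr 1 with η
    push_cast
    ring_nf
  rw [h', abs_of_pos (inv_pos.2 hs), real_smul] at h
  have hs' : (s : ℂ) ≠ 0 := by exact_mod_cast hs.ne'
  rw [Real.rpow_add_one hs.ne', ofReal_mul, mul_right_comm, h]
  push_cast
  field_simp

lemma integral_abs_rpow_mul_exp (a : ℝ) {s : ℝ} (hs : 0 < s) :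
    ∫ ξ : ℝ, |ξ| ^ a * Real.exp (-(1 / (4 * s ^ 2)) * ξ ^ 2)
      = s ^ (a + 1) * ∫ η : ℝ, |η| ^ a * Real.exp (-(1 / 4) * η ^ 2) := by
  have h := Measure.integral_comp_mul_left
    (fun ξ : ℝ => |ξ| ^ a * Real.exp (-(1 / (4 * s ^ 2)) * ξ ^ 2)) s
  simp only [abs_rpow_mul_exp_comp_mul_left a hs, integral_const_mul] at h
  rw [abs_of_pos (inv_pos.2 hs), smul_eq_mul] at h
  rw [Real.rpow_add_one hs.ne', mul_right_comm, h]
  field_simp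

lemma integrable_uncurry_mul_of_nonneg {k : ℝ → ℝ → ℝ} (hk : Measurable (Function.uncurry k))
    (hnn : ∀ x, ∀ t, 0 < t → 0 ≤ k x t) (hx : ∀ t, 0 < t → Integrable fun x => k x t)
    (ht : IntegrableOn (fun t => ∫ x, k x t) (Ioi 0)) {e : ℝ → ℂ} (he : Continuous e)
    (hnorm : ∀ x, ‖e x‖ = 1) :
    Integrable (Function.uncurry fun x t => e x * (k x t : ℂ))
      (volume.prod (volume.restrict (Ioi 0))) := by
  have hm : Measurable (Function.uncurry fun x t => e x * (k x t : ℂ)) :=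
    (he.measurable.comp measurable_fst).mul (measurable_ofReal.comp hk)
  rw [integrable_prod_iff' hm.aestronglyMeasurable]
  constructor
  · filter_upwards [ae_restrict_mem measurableSet_Ioi] with t h
    exact (hx t h).ofReal.bdd_mul (c := 1) he.aestronglyMeasurable
      (ae_of_all _ fun x => (hnorm x).le)
  · refine ht.congr_fun (fun t h => ?_) measurableSet_Ioi
    refine integral_congr_ae (ae_of_all _ fun x => ?_)
    simp [hnorm, abs_of_nonneg (hnn x t h)]

/-- The density of `⟨x⟩^{-2r}`, up to the factor `1 / Γ(r)`, as a superposition of Fourier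
transforms of Gaussians. -/
noncomputable def subordinationDensity (r t : ℝ) : ℝ :=
  t ^ (r - 1) * Real.exp (-t) * √(Real.pi / t)

lemma subordinationDensity_nonneg (r : ℝ) {t : ℝ} (ht : 0 < t) : 0 ≤ subordinationDensity r t := by
  unfold subordinationDensity
  positivity

lemma integrableOn_subordinationDensity_mul_rpow {r b : ℝ} (h : 0 < r - 1 / 2 + b / 2) :
    IntegrableOn (fun t => subordinationDensity r t * √t ^ b) (Ioi 0) := by
  refine IntegrableOn.congr_fun ((Real.GammaIntegral_convergent h).const_mul √Real.pi)
    (fun t ht => ?_) measurableSet_Ioi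
  have ht : 0 < t := ht
  rw [subordinationDensity, Real.sqrt_div Real.pi_pos.le, Real.sqrt_eq_rpow t,
    ← Real.rpow_mul ht.le,
    show r - 1 / 2 + b / 2 - 1 = (r - 1) + (1 / 2 * b) - 1 / 2 by ring, Real.rpow_sub ht,
    Real.rpow_add ht]
  ring

lemma integrableOn_subordinationDensity {r : ℝ} (hr : 1 / 2 < r) :
    IntegrableOn (subordinationDensity r) (Ioi 0) := by
  simpa using integrableOn_subordinationDensity_mul_rpow (r := r) (b := 0) (by linarith)

lemma jap_rpow_eq {r : ℝ} (hr : 0 < r) (x : ℝ) :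
    jap x ^ (-(2 * r)) = (Real.Gamma r)⁻¹ *
      ∫ t in Ioi (0 : ℝ), t ^ (r - 1) * Real.exp (-((1 + x ^ 2) * t)) := by
  have h1 : 0 < 1 + x ^ 2 := by positivity
  rw [Real.integral_rpow_mul_exp_neg_mul_Ioi hr h1, jap, Real.sqrt_eq_rpow, ← Real.rpow_mul h1.le,
    one_div (1 + x ^ 2), Real.inv_rpow h1.le, ← Real.rpow_neg h1.le]
  have := (Real.Gamma_pos_of_pos hr).ne'
  field_simp

lemma FT_jap_rpow {r : ℝ} (hr : 1 / 2 < r) (ξ : ℝ) :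
    FT (fun x => ((jap x ^ (-(2 * r)) : ℝ) : ℂ)) ξ = (((Real.Gamma r)⁻¹ *
      ∫ t in Ioi (0 : ℝ), subordinationDensity r t * Real.exp (-(1 / (4 * t)) * ξ ^ 2) : ℝ) :
        ℂ) := by
  set k : ℝ → ℝ → ℝ := fun x t => t ^ (r - 1) * Real.exp (-((1 + x ^ 2) * t)) with hk
  have hk' (x t : ℝ) : k x t = t ^ (r - 1) * Real.exp (-t) * Real.exp (-t * x ^ 2) := by
    rw [hk, mul_assoc, ← Real.exp_add]
    ring_nf
  have hint : Integrable (Function.uncurry fun (x t : ℝ) => cexp (-(I * x * ξ)) * (k x t : ℂ))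
      (volume.prod (volume.restrict (Ioi 0))) := by
    refine integrable_uncurry_mul_of_nonneg (e := fun x : ℝ => cexp (-(I * x * ξ))) ?_
      (fun x t ht => by positivity) (fun t ht => ?_) ?_ (by fun_prop) fun x => ?_
    · simp only [hk, Function.uncurry_def]
      fun_prop
    · simp only [hk']
      exact (integrable_exp_neg_mul_sq ht).const_mul _
    · simp only [hk', integral_const_mul, integral_gaussian]
      exact integrableOn_subordinationDensity hr
    · rw [← norm_cexp_I_mul_mul x (-ξ)]
      push_cast
      ring_nf
  have hinner (t : ℝ) (ht : 0 < t) : ∫ x : ℝ, cexp (-(I * x * ξ)) * (k x t : ℂ)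
      = ((subordinationDensity r t * Real.exp (-(1 / (4 * t)) * ξ ^ 2) : ℝ) : ℂ) := by
    have h := fourierIntegral_gaussian (b := t) (by simpa using ht) (-ξ)
    have hsqrt : ((Real.pi : ℂ) / t) ^ (1 / 2 : ℂ) = ((√(Real.pi / t) : ℝ) : ℂ) := by
      rw [Real.sqrt_eq_rpow, ofReal_cpow (by positivity)]
      push_cast
      rfl
    rw [hsqrt] at h
    simp only [hk']
    calc _ = ∫ x : ℝ, ((t ^ (r - 1) * Real.exp (-t) : ℝ) : ℂ) *
            (cexp (I * (-ξ) * x) * cexp (-t * x ^ 2)) := by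
          congr 1 with x
          push_cast
          ring_nf
      _ = _ := by
          rw [integral_const_mul, h, subordinationDensity]
          push_cast
          ring_nf
  have hpoint (x : ℝ) : cexp (-(I * x * ξ)) * ((jap x ^ (-(2 * r)) : ℝ) : ℂ)
      = ((Real.Gamma r)⁻¹ : ℝ) * ∫ t in Ioi (0 : ℝ), cexp (-(I * x * ξ)) * (k x t : ℂ) := by
    rw [jap_rpow_eq (by linarith), integral_const_mul, integral_complex_ofReal]
    push_cast
    ring
  simp only [FT, hpoint]
  rw [integral_const_mul, integral_integral_swap hint, ofReal_mul, ← integral_complex_ofReal]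
  congr 1
  exact setIntegral_congr_fun measurableSet_Ioi hinner

end Subordination

section Multiplier

open Set Filter Topology

variable {r α : ℝ}

lemma continuous_FTinv {v : ℝ → ℂ} (hv : Integrable v) : Continuous (FTinv v) := by
  suffices Continuous fun x : ℝ => ∫ ξ : ℝ, cexp (I * x * ξ) * v ξ from
    this.const_smul (2 * Real.pi)⁻¹
  refine continuous_of_dominated (bound := fun ξ => ‖v ξ‖) (fun x => ?_)
    (fun x => ae_of_all _ fun ξ => ?_) hv.norm (ae_of_all _ fun ξ => by fun_prop)
  · exact (Continuous.aestronglyMeasurable (by fun_prop)).mul hv.aestronglyMeasurable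
  · rw [norm_mul, norm_cexp_I_mul_mul, one_mul]

lemma integrable_uncurry_cexp_mul_subordination (hr : 1 / 2 < r) (hα : -1 < α) (x : ℝ) :
    Integrable (Function.uncurry fun (ξ t : ℝ) => cexp (I * x * ξ) * ((|ξ| ^ α *
      (subordinationDensity r t * Real.exp (-(1 / (4 * t)) * ξ ^ 2)) : ℝ) : ℂ))
      (volume.prod (volume.restrict (Ioi 0))) := by
  refine integrable_uncurry_mul_of_nonneg (e := fun ξ : ℝ => cexp (I * x * ξ))
    (k := fun ξ t => |ξ| ^ α * (subordinationDensity r t * Real.exp (-(1 / (4 * t)) * ξ ^ 2)))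
    ?_ (fun ξ t ht => ?_) (fun t ht => ?_) ?_ (by fun_prop)
    (norm_cexp_I_mul_mul x)
  · simp only [subordinationDensity, Function.uncurry_def]
    fun_prop
  · have := subordinationDensity_nonneg r ht
    positivity
  · simp only [mul_left_comm (_ ^ α)]
    exact (integrable_abs_rpow_mul_exp_neg_mul_sq hα (by positivity)).const_mul _
  · refine IntegrableOn.congr_fun ((integrableOn_subordinationDensity_mul_rpow (r := r)
      (b := α + 1) (by linarith)).mul_const (∫ η : ℝ, |η| ^ α * Real.exp (-(1 / 4) * η ^ 2)))
      (fun t ht => ?_) measurableSet_Ioi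
    have ht : 0 < t := ht
    have h := integral_abs_rpow_mul_exp α (Real.sqrt_pos.2 ht)
    rw [Real.sq_sqrt ht.le] at h
    simp only [mul_left_comm (_ ^ α), integral_const_mul, h, mul_assoc]

lemma abs_rpow_mul_FT_jap_rpow (hr : 1 / 2 < r) (ξ : ℝ) :
    ((|ξ| ^ α : ℝ) : ℂ) * FT (fun x => ((jap x ^ (-(2 * r)) : ℝ) : ℂ)) ξ
      = ((Real.Gamma r)⁻¹ : ℝ) * ∫ t in Ioi (0 : ℝ), ((|ξ| ^ α *
        (subordinationDensity r t * Real.exp (-(1 / (4 * t)) * ξ ^ 2)) : ℝ) : ℂ) := by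
  rw [FT_jap_rpow hr, integral_complex_ofReal, integral_const_mul]
  push_cast
  ring

lemma integrable_abs_rpow_mul_FT_jap_rpow (hr : 1 / 2 < r) (hα : -1 < α) :
    Integrable fun ξ : ℝ =>
      ((|ξ| ^ α : ℝ) : ℂ) * FT (fun x => ((jap x ^ (-(2 * r)) : ℝ) : ℂ)) ξ := by
  simp only [abs_rpow_mul_FT_jap_rpow hr]
  refine Integrable.const_mul ?_ _
  simpa using (integrable_uncurry_cexp_mul_subordination hr hα 0).integral_prod_left

/-- Subordination formula for `|D|^α ⟨x⟩^{-2r}`. -/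
lemma fracD_jap_rpow (hr : 1 / 2 < r) (hα : -1 < α) (x : ℝ) :
    fracD α (fun y => ((jap y ^ (-(2 * r)) : ℝ) : ℂ)) x
      = ((2 * Real.pi)⁻¹ * (Real.Gamma r)⁻¹ : ℝ) * ∫ t in Ioi (0 : ℝ),
        ((subordinationDensity r t * √t ^ (α + 1) : ℝ) : ℂ) * gaussFT α (x * √t) := by
  simp only [fracD, FTinv, abs_rpow_mul_FT_jap_rpow hr]
  rw [real_smul, ofReal_mul (2 * Real.pi)⁻¹, mul_assoc]
  refine congrArg _ ?_
  simp only [mul_left_comm (cexp _), ← integral_const_mul (cexp _)]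
  rw [integral_const_mul,
    integral_integral_swap (integrable_uncurry_cexp_mul_subordination hr hα x)]
  refine congrArg _ (setIntegral_congr_fun measurableSet_Ioi fun t ht => ?_)
  have ht : 0 < t := ht
  have h := integral_cexp_mul_abs_rpow_mul_exp α x (Real.sqrt_pos.2 ht)
  rw [Real.sq_sqrt ht.le] at h
  simp only [mul_left_comm (_ ^ α), ofReal_mul (subordinationDensity r t),
    mul_left_comm (cexp _), integral_const_mul]
  rw [h]
  ring

lemma norm_fracD_jap_rpow_le (hr : 1 / 2 < r) (hα : -1 < α) (x : ℝ) {B : ℝ → ℝ}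
    (hB : IntegrableOn B (Ioi 0))
    (h : ∀ t, 0 < t → subordinationDensity r t * √t ^ (α + 1) * ‖gaussFT α (x * √t)‖ ≤ B t) :
    ‖fracD α (fun y => ((jap y ^ (-(2 * r)) : ℝ) : ℂ)) x‖
      ≤ (2 * Real.pi)⁻¹ * (Real.Gamma r)⁻¹ * ∫ t in Ioi (0 : ℝ), B t := by
  have hΓ := Real.Gamma_pos_of_pos (by linarith : 0 < r)
  rw [fracD_jap_rpow hr hα, norm_mul, norm_real, Real.norm_of_nonneg (by positivity)]
  refine mul_le_mul_of_nonneg_left (norm_integral_le_of_norm_le hB ?_) (by positivity)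
  filter_upwards [ae_restrict_mem measurableSet_Ioi] with t ht
  have := subordinationDensity_nonneg r ht
  rw [norm_mul, norm_real, Real.norm_of_nonneg (by positivity)]
  exact h t ht

lemma exists_norm_fracD_jap_rpow_le (hr : 1 / 2 < r) (hα : -1 < α) :
    ∃ C, 0 ≤ C ∧ ∀ x, ‖fracD α (fun y => ((jap y ^ (-(2 * r)) : ℝ) : ℂ)) x‖ ≤ C := by
  obtain ⟨C, hC, h⟩ := exists_norm_gaussFT_le hα
  have hi := (integrableOn_subordinationDensity_mul_rpow (r := r) (b := α + 1)
    (by linarith)).mul_const C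
  have hle (x : ℝ) := norm_fracD_jap_rpow_le hr hα x hi fun t ht =>
    mul_le_mul_of_nonneg_left (h (x * √t))
      (mul_nonneg (subordinationDensity_nonneg r ht) (by positivity))
  exact ⟨_, (norm_nonneg _).trans (hle 0), hle⟩

lemma exists_norm_fracD_jap_rpow_le_mul_rpow (hr : 1 / 2 < r) (hα : -1 < α) :
    ∃ C, 0 ≤ C ∧ ∀ x, x ≠ 0 →
      ‖fracD α (fun y => ((jap y ^ (-(2 * r)) : ℝ) : ℂ)) x‖ ≤ C * |x| ^ (-(α + 1)) := by
  obtain ⟨C, hC, h⟩ := exists_norm_gaussFT_le_mul_rpow hα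
  have hi := (integrableOn_subordinationDensity hr).mul_const C
  have hle (x : ℝ) (hx : x ≠ 0) := norm_fracD_jap_rpow_le hr hα x
    (hi.mul_const (|x| ^ (-(α + 1)))) fun t ht => by
      have hs : 0 < √t := Real.sqrt_pos.2 ht
      have hm := subordinationDensity_nonneg r ht
      refine (mul_le_mul_of_nonneg_left (h (x * √t) (mul_ne_zero hx hs.ne'))
        (by positivity)).trans_eq ?_
      rw [abs_mul, abs_of_pos hs, Real.mul_rpow (abs_nonneg x) hs.le, Real.rpow_neg hs.le]
      have := (Real.rpow_pos_of_pos hs (α + 1)).ne'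
      field_simp
  simp only [integral_mul_const, ← mul_assoc] at hle
  refine ⟨_, ?_, hle⟩
  simpa using (norm_nonneg _).trans (hle 1 one_ne_zero)

end Multiplier

/-- `g = |D|^α(⟨·⟩^{-2r})` is continuous with decay `|g(x)| ≤ C⟨x⟩^{-(α+1)}`. -/
theorem stmt_7 (r α : ℝ) (hr : 1 / 2 < r) (hα : -1 < α) :
    Continuous (fracD α (fun x => ((jap x ^ (-(2 * r)) : ℝ) : ℂ))) ∧
    ∃ C : ℝ, 0 < C ∧ ∀ x : ℝ,
      ‖fracD α (fun y => ((jap y ^ (-(2 * r)) : ℝ) : ℂ)) x‖ ≤ C * jap x ^ (-(α + 1)) := by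
  refine ⟨continuous_FTinv (integrable_abs_rpow_mul_FT_jap_rpow hr hα), ?_⟩
  obtain ⟨A, hA, hA'⟩ := exists_norm_fracD_jap_rpow_le hr hα
  obtain ⟨B, hB, hB'⟩ := exists_norm_fracD_jap_rpow_le_mul_rpow hr hα
  refine ⟨2 ^ (α + 1) * (A + B + 1), by positivity, fun x => ?_⟩
  have hj : 0 < jap x := Real.sqrt_pos.2 (by positivity)
  have compare {z : ℝ} (hz : 0 < z) (hjz : jap x ≤ 2 * z) :
      z ^ (-(α + 1)) ≤ 2 ^ (α + 1) * jap x ^ (-(α + 1)) := by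
    have := Real.rpow_le_rpow_of_nonpos hj hjz (by linarith : -(α + 1) ≤ 0)
    rw [Real.mul_rpow two_pos.le hz.le, Real.rpow_neg two_pos.le, inv_mul_eq_div,
      div_le_iff₀ (by positivity)] at this
    linarith
  have hpos : 0 ≤ 2 ^ (α + 1) * jap x ^ (-(α + 1)) := by positivity
  rcases le_or_gt 1 |x| with h | h
  · have hx : x ≠ 0 := abs_pos.1 (by linarith)
    have := compare (z := |x|) (by linarith) (Real.sqrt_le_iff.2
      ⟨by positivity, by rw [mul_pow, sq_abs]; nlinarith [sq_abs x]⟩)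
    nlinarith [hB' x hx, mul_le_mul_of_nonneg_left this hB, mul_nonneg hA hpos]
  · have := compare (z := 1) one_pos (Real.sqrt_le_iff.2
      ⟨by norm_num, by nlinarith [sq_abs x, abs_nonneg x]⟩)
    rw [Real.one_rpow] at this
    nlinarith [hA' x, mul_le_mul_of_nonneg_left this hA, mul_nonneg hB hpos]
end

section
/- Let α ∈ [1,2] and r ∈ (1/2, (α+1)/2]. Let φ(x) = ∫_{−∞}^x ⟨s⟩^{−2r} ds and φ'(x) = ⟨x⟩^{−2r}, and set ϕ = √(φ') = ⟨x⟩^{−r}. There exists C > 0 such that for all real-valued u in the Schwartz class, ∫ (−|D|^α u) u φ'(x) dx ≤ −∫ (|D|^{α/2}(ϕ u))² dx + C ∫ u² φ'(x) dx. -/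
open MeasureTheory Complex ComplexConjugate

open Filter Topology Set
open scoped FourierTransform

/-! ### Fourier multipliers with frequency variable `η = ξ / 2π` -/

lemma FT_eq_fourier (u : ℝ → ℂ) (η : ℝ) : FT u (2 * Real.pi * η) = 𝓕 u η := by
  rw [Real.fourier_real_eq_integral_exp_smul, FT]
  congr 1 with x
  rw [smul_eq_mul]
  congr 2
  push_cast
  ring

lemma FTinv_eq_fourierInv (v : ℝ → ℂ) (x : ℝ) :
    FTinv v x = 𝓕⁻ (fun η => v (2 * Real.pi * η)) x := by
  have h := Measure.integral_comp_mul_left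
    (fun ξ : ℝ => Complex.exp (Complex.I * (x : ℂ) * (ξ : ℂ)) * v ξ) (2 * Real.pi)
  rw [abs_of_pos (by positivity)] at h
  rw [FTinv, ← h, Real.fourierInv_eq']
  congr 1 with η
  rw [smul_eq_mul]
  congr 2
  simp only [RCLike.inner_apply, conj_trivial]
  push_cast
  ring

/-- The symbol of `|D|^a` in the frequency variable `η = ξ / 2π`. -/
noncomputable def fracSymbol (a η : ℝ) : ℝ := |2 * Real.pi * η| ^ a

lemma fracD_eq (a : ℝ) (u : ℝ → ℂ) :
    fracD a u = 𝓕⁻ (fun η => (fracSymbol a η : ℂ) * 𝓕 u η) := by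
  ext x
  simp only [fracD, FTinv_eq_fourierInv, FT_eq_fourier, fracSymbol]

lemma fracSymbol_nonneg (a η : ℝ) : 0 ≤ fracSymbol a η := by unfold fracSymbol; positivity

lemma continuous_fracSymbol {a : ℝ} (ha : 0 ≤ a) : Continuous (fracSymbol a) := by
  unfold fracSymbol
  exact (by fun_prop : Continuous fun η : ℝ => |2 * Real.pi * η|).rpow_const fun _ => Or.inr ha

/-- The smooth symbol `(ε + (2πη)²)^{a/2}`, written so that its temperate growth is manifest. -/
noncomputable def besselSymbol (a ε η : ℝ) : ℝ :=
  ε ^ a * (1 + ‖(2 * Real.pi / ε) * η‖ ^ 2) ^ (a / 2)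

lemma besselSymbol_eq {a ε : ℝ} (hε : 0 < ε) (η : ℝ) :
    besselSymbol a ε η = (ε ^ 2 + (2 * Real.pi * η) ^ 2) ^ (a / 2) := by
  have h1 : ε ^ a = (ε ^ 2) ^ (a / 2) := by
    rw [← Real.rpow_natCast, ← Real.rpow_mul hε.le]
    congr 1
    push_cast
    ring
  rw [besselSymbol, h1, ← Real.mul_rpow (by positivity) (by positivity), Real.norm_eq_abs, sq_abs]
  congr 1
  field_simp

lemma hasTemperateGrowth_besselSymbol (a ε : ℝ) :
    (fun η => (besselSymbol a ε η : ℂ)).HasTemperateGrowth := by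
  have h1 : (fun η : ℝ => (2 * Real.pi / ε) * η).HasTemperateGrowth := by fun_prop
  have h2 := (Function.hasTemperateGrowth_one_add_norm_sq_rpow ℝ (a / 2)).comp h1
  have h3 : (fun η => besselSymbol a ε η).HasTemperateGrowth := by
    unfold besselSymbol
    exact (Function.HasTemperateGrowth.const (ε ^ a)).mul h2
  exact Function.Complex.hasTemperateGrowth_ofReal.comp h3

lemma fracSymbol_eq (a η : ℝ) : fracSymbol a η = ((2 * Real.pi * η) ^ 2) ^ (a / 2) := by
  rw [fracSymbol, ← sq_abs, ← Real.rpow_natCast, ← Real.rpow_mul (abs_nonneg _)]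
  congr 1
  push_cast
  ring

lemma fracSymbol_le_besselSymbol {a ε : ℝ} (ha : 0 ≤ a) (hε : 0 < ε) (η : ℝ) :
    fracSymbol a η ≤ besselSymbol a ε η := by
  rw [besselSymbol_eq hε, fracSymbol_eq]
  gcongr
  linarith [sq_nonneg ε]

lemma besselSymbol_mono {a ε δ : ℝ} (ha : 0 ≤ a) (hε : 0 < ε) (h : ε ≤ δ) (η : ℝ) :
    besselSymbol a ε η ≤ besselSymbol a δ η := by
  rw [besselSymbol_eq hε, besselSymbol_eq (hε.trans_le h)]
  gcongr

lemma besselSymbol_nonneg {a ε : ℝ} (hε : 0 < ε) (η : ℝ) : 0 ≤ besselSymbol a ε η := by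
  unfold besselSymbol; positivity

lemma tendsto_besselSymbol {a : ℝ} (ha : 0 ≤ a) (η : ℝ) :
    Tendsto (fun n : ℕ => besselSymbol a (1 / ((n : ℝ) + 1)) η) atTop (𝓝 (fracSymbol a η)) := by
  have h1 : Tendsto (fun n : ℕ => ((1 / ((n : ℝ) + 1)) ^ 2 + (2 * Real.pi * η) ^ 2) ^ (a / 2))
      atTop (𝓝 ((0 ^ 2 + (2 * Real.pi * η) ^ 2) ^ (a / 2))) :=
    ((tendsto_one_div_add_atTop_nhds_zero_nat.pow 2).add_const _).rpow_const (Or.inr (by positivity))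
  rw [fracSymbol_eq]
  refine Tendsto.congr (fun n => (besselSymbol_eq (by positivity) η).symm) ?_
  simpa using h1

/-- Multiplication of a Schwartz function by a Bessel symbol. -/
noncomputable def besselMul (a ε : ℝ) (f : SchwartzMap ℝ ℂ) : SchwartzMap ℝ ℂ :=
  SchwartzMap.smulLeftCLM ℂ (fun η => (besselSymbol a ε η : ℂ)) f

lemma besselMul_apply (a ε : ℝ) (f : SchwartzMap ℝ ℂ) (η : ℝ) :
    besselMul a ε f η = besselSymbol a ε η * f η := by
  rw [besselMul, SchwartzMap.smulLeftCLM_apply_apply (hasTemperateGrowth_besselSymbol a ε),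
    smul_eq_mul]

lemma integrable_fracSymbol_mul {a : ℝ} (ha : 0 ≤ a) (f : SchwartzMap ℝ ℂ) :
    Integrable (fun η => (fracSymbol a η : ℂ) * f η) := by
  refine (besselMul a 1 f).integrable.mono
    ((Complex.continuous_ofReal.comp (continuous_fracSymbol ha)).mul
      f.continuous).aestronglyMeasurable (.of_forall fun η => ?_)
  rw [besselMul_apply, norm_mul, norm_mul, Complex.norm_real, Complex.norm_real,
    Real.norm_of_nonneg (fracSymbol_nonneg a η),
    Real.norm_of_nonneg (besselSymbol_nonneg one_pos η)]
  gcongr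
  exact fracSymbol_le_besselSymbol ha one_pos η

/-- The product of two Schwartz functions. -/
lemma exists_schwartz_mul (f g : SchwartzMap ℝ ℂ) :
    ∃ k : SchwartzMap ℝ ℂ, ∀ x, k x = f x * g x :=
  ⟨SchwartzMap.smulLeftCLM ℂ f g, fun x => by
    rw [SchwartzMap.smulLeftCLM_apply_apply f.hasTemperateGrowth, smul_eq_mul]⟩

lemma integral_fourierInv_mul {f g : ℝ → ℂ} (hf : Integrable f) (hg : Integrable g) :
    ∫ x, 𝓕⁻ f x * g x = ∫ η, f η * 𝓕⁻ g η := by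
  have h := VectorFourier.integral_fourierIntegral_smul_eq_flip (L := -innerₗ ℝ) (f := f) (g := g)
    Real.continuous_fourierChar (continuous_inner (𝕜 := ℝ) (E := ℝ)).neg hf hg
  have hflip : (-innerₗ ℝ).flip = -innerₗ ℝ := by
    ext
    simp
  rw [hflip] at h
  exact h

/-- One inequality of the Plancherel identity for `|D|^a` applied to a Schwartz function. -/
lemma integral_norm_sq_fracD_le {a : ℝ} (ha : 0 ≤ a) (f : SchwartzMap ℝ ℂ) :
    ∫ x, ‖fracD a f x‖ ^ 2 ≤ ∫ η, (fracSymbol a η * ‖𝓕 f η‖) ^ 2 := by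
  set ε : ℕ → ℝ := fun n => 1 / ((n : ℝ) + 1) with hε_def
  have hε : ∀ n, 0 < ε n := fun n => by positivity
  have hε1 : ∀ n, ε n ≤ 1 := fun n => by
    rw [hε_def, div_le_one (by positivity)]
    linarith [n.cast_nonneg (α := ℝ)]
  set G : ℕ → SchwartzMap ℝ ℂ := fun n => besselMul a (ε n) (𝓕 f) with hG
  have hGnorm : ∀ n η, ‖G n η‖ = besselSymbol a (ε n) η * ‖𝓕 f η‖ := fun n η => by
    rw [hG, besselMul_apply, norm_mul, Complex.norm_real,
      Real.norm_of_nonneg (besselSymbol_nonneg (hε n) η)]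
  have hGle : ∀ n η, ‖G n η‖ ≤ ‖besselMul a 1 (𝓕 f) η‖ := fun n η => by
    rw [hGnorm, besselMul_apply, norm_mul, Complex.norm_real,
      Real.norm_of_nonneg (besselSymbol_nonneg one_pos η)]
    gcongr
    exact besselSymbol_mono ha (hε n) (hε1 n) η
  have hlim : ∀ x, Tendsto (fun n => 𝓕⁻ (G n) x) atTop (𝓝 (fracD a f x)) := fun x => by
    simp only [SchwartzMap.fourierInv_coe, fracD_eq, Real.fourierInv_eq]
    refine tendsto_integral_of_dominated_convergence (fun η => ‖besselMul a 1 (𝓕 f) η‖)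
      (fun n => ?_) (besselMul a 1 (𝓕 f)).integrable.norm (fun n => .of_forall fun η => ?_)
      (.of_forall fun η => ?_)
    · exact ((Real.continuous_fourierChar.comp (by fun_prop)).smul
        (G n).continuous).aestronglyMeasurable
    · rw [Circle.norm_smul]
      exact hGle n η
    · refine Tendsto.const_smul ?_ _
      simp only [hG, besselMul_apply]
      exact ((Complex.continuous_ofReal.tendsto _).comp (tendsto_besselSymbol ha η)).mul_const _
  have hint : ∀ n, ∫ x, ‖𝓕⁻ (G n) x‖ ^ 2 = ∫ η, ‖G n η‖ ^ 2 := fun n => by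
    rw [← SchwartzMap.integral_norm_sq_fourier, FourierTransform.fourier_fourierInv_eq]
  have hsq : ∀ g : SchwartzMap ℝ ℂ, Integrable (fun x => ‖g x‖ ^ 2) := fun g =>
    (g.memLp 2).integrable_norm_pow two_ne_zero
  have hconv : Tendsto (fun n => ∫ η, ‖G n η‖ ^ 2) atTop
      (𝓝 (∫ η, (fracSymbol a η * ‖𝓕 f η‖) ^ 2)) := by
    refine tendsto_integral_of_dominated_convergence (fun η => ‖besselMul a 1 (𝓕 f) η‖ ^ 2)
      (fun n => ((G n).continuous.norm.pow 2).aestronglyMeasurable) (hsq _)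
      (fun n => .of_forall fun η => ?_) (.of_forall fun η => ?_)
    · rw [norm_pow, norm_norm]
      gcongr
      exact hGle n η
    · simp only [hGnorm]
      exact ((tendsto_besselSymbol ha η).mul_const _).pow 2
  have hfatou : ∫⁻ x, ENNReal.ofReal (‖fracD a f x‖ ^ 2) ≤
      ENNReal.ofReal (∫ η, (fracSymbol a η * ‖𝓕 f η‖) ^ 2) := by
    calc ∫⁻ x, ENNReal.ofReal (‖fracD a f x‖ ^ 2)
        = ∫⁻ x, liminf (fun n => ENNReal.ofReal (‖𝓕⁻ (G n) x‖ ^ 2)) atTop := by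
          congr 1 with x
          exact ((ENNReal.continuous_ofReal.tendsto _).comp ((hlim x).norm.pow 2)).liminf_eq.symm
      _ ≤ liminf (fun n => ∫⁻ x, ENNReal.ofReal (‖𝓕⁻ (G n) x‖ ^ 2)) atTop :=
          lintegral_liminf_le fun n =>
            ((𝓕⁻ (G n)).continuous.norm.pow 2).measurable.ennreal_ofReal
      _ = liminf (fun n => ENNReal.ofReal (∫ η, ‖G n η‖ ^ 2)) atTop := by
          congr 1 with n
          rw [← hint, ofReal_integral_eq_lintegral_ofReal (hsq _) (.of_forall fun _ => by positivity)]
      _ = _ := ((ENNReal.continuous_ofReal.tendsto _).comp hconv).liminf_eq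
  by_cases hi : Integrable fun x => ‖fracD a f x‖ ^ 2
  · rwa [← ofReal_integral_eq_lintegral_ofReal hi (.of_forall fun _ => by positivity),
      ENNReal.ofReal_le_ofReal_iff (integral_nonneg fun _ => by positivity)] at hfatou
  · rw [integral_undef hi]
    exact integral_nonneg fun _ => by positivity

/-! ### The weight -/

lemma one_le_jap (x : ℝ) : 1 ≤ jap x := by
  rw [jap, Real.one_le_sqrt]
  nlinarith [sq_nonneg x]

lemma jap_pos (x : ℝ) : 0 < jap x := one_pos.trans_le (one_le_jap x)

lemma jap_le_add {x y h : ℝ} (hxy : |x - y| ≤ h) : jap x ≤ jap y + h := by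
  have hy := jap_pos y
  have hh : 0 ≤ h := (abs_nonneg _).trans hxy
  have hy2 : jap y ^ 2 = 1 + y ^ 2 := Real.sq_sqrt (by positivity)
  have hyy : |y| ≤ jap y := by
    rw [jap, ← Real.sqrt_sq_eq_abs]
    exact Real.sqrt_le_sqrt (by linarith)
  have hx : |x| ≤ |y| + h := by
    calc |x| = |y + (x - y)| := by ring_nf
      _ ≤ |y| + |x - y| := abs_add_le _ _
      _ ≤ |y| + h := by gcongr
  have hx2 : x ^ 2 ≤ (|y| + h) ^ 2 := by
    rw [← sq_abs x]
    gcongr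
  rw [jap, Real.sqrt_le_left (by positivity)]
  nlinarith [sq_abs y]

/-- The weight `⟨x⟩^{-r}`. -/
noncomputable def weight (r x : ℝ) : ℝ := jap x ^ (-r)

lemma weight_pos (r x : ℝ) : 0 < weight r x := Real.rpow_pos_of_pos (jap_pos x) _

lemma weight_eq (r x : ℝ) : weight r x = (1 + ‖x‖ ^ 2) ^ (-r / 2) := by
  rw [weight, jap, Real.sqrt_eq_rpow, ← Real.rpow_mul (by positivity), Real.norm_eq_abs, sq_abs]
  congr 1
  ring

lemma hasTemperateGrowth_weight (r : ℝ) : (weight r).HasTemperateGrowth := by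
  rw [funext (weight_eq r)]
  exact Function.hasTemperateGrowth_one_add_norm_sq_rpow ℝ _

lemma continuous_weight (r : ℝ) : Continuous (weight r) :=
  (hasTemperateGrowth_weight r).1.continuous

lemma weight_sq (r x : ℝ) : weight r x ^ 2 = jap x ^ (-(2 * r)) := by
  rw [weight, ← Real.rpow_natCast, ← Real.rpow_mul (jap_pos x).le]
  congr 1
  push_cast
  ring

lemma integrable_weight_sq {r : ℝ} (hr : 1 / 2 < r) : Integrable fun x => weight r x ^ 2 := by
  have h := integrable_rpow_neg_one_add_norm_sq (E := ℝ) (μ := volume) (r := 2 * r)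
    (by rw [Module.finrank_self]; push_cast; linarith)
  refine h.congr (.of_forall fun x => ?_)
  simp only [weight_eq]
  rw [← Real.rpow_natCast (_ ^ _) 2, ← Real.rpow_mul (by positivity)]
  congr 1
  push_cast
  ring

lemma weight_le_one_add_mul {r x y h : ℝ} (hr : 0 ≤ r) (hr2 : r ≤ 2) (hxy : |x - y| ≤ h)
    (h1 : h ≤ 1) : weight r x ≤ (1 + 3 * h) * weight r y := by
  have hh : 0 ≤ h := (abs_nonneg _).trans hxy
  have hx := jap_pos x
  have hy : jap y ≤ (1 + h) * jap x := by
    have := jap_le_add (x := y) (y := x) ((abs_sub_comm y x).trans_le hxy)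
    nlinarith [one_le_jap x]
  have h2 : jap y ^ r ≤ (1 + 3 * h) * jap x ^ r := by
    calc jap y ^ r ≤ ((1 + h) * jap x) ^ r := by
          have := (jap_pos y).le
          gcongr
      _ = (1 + h) ^ r * jap x ^ r := Real.mul_rpow (by positivity) hx.le
      _ ≤ (1 + h) ^ (2 : ℝ) * jap x ^ r := by
          gcongr
          linarith
      _ ≤ (1 + 3 * h) * jap x ^ r := by
          gcongr
          rw [Real.rpow_two]
          nlinarith
  have hxr := Real.rpow_pos_of_pos hx r
  have hyr := Real.rpow_pos_of_pos (jap_pos y) r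
  rw [weight, weight, Real.rpow_neg hx.le, Real.rpow_neg (jap_pos y).le, inv_le_iff_one_le_mul₀ hxr]
  field_simp
  linarith

lemma sq_weight_sub_le_of_le_one {r x y h : ℝ} (hr : 0 ≤ r) (hr2 : r ≤ 2) (hxy : |x - y| ≤ h)
    (h1 : h ≤ 1) : (weight r x - weight r y) ^ 2 ≤ 9 * h ^ 2 * (weight r x * weight r y) := by
  have hh : 0 ≤ h := (abs_nonneg _).trans hxy
  have key : ∀ a b : ℝ, 0 < b → b ≤ a → a ≤ (1 + 3 * h) * b →
      (a - b) ^ 2 ≤ 9 * h ^ 2 * (a * b) := fun a b hb hba hab => by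
    calc (a - b) ^ 2 ≤ (3 * h * b) ^ 2 := by
          have : 0 ≤ a - b := by linarith
          gcongr
          linarith
      _ = 9 * h ^ 2 * (b * b) := by ring
      _ ≤ 9 * h ^ 2 * (a * b) := by gcongr
  rcases le_total (weight r y) (weight r x) with h2 | h2
  · exact key _ _ (weight_pos r y) h2 (weight_le_one_add_mul hr hr2 hxy h1)
  · have := key _ _ (weight_pos r x) h2
      (weight_le_one_add_mul hr hr2 (by rwa [abs_sub_comm]) h1)
    linarith

lemma weight_le_mul_weight {r x y h : ℝ} (hr : 0 ≤ r) (hxy : |x - y| ≤ h) :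
    weight r x ≤ 2 ^ r * (1 + h ^ r * weight r x) * weight r y := by
  have hh : 0 ≤ h := (abs_nonneg _).trans hxy
  have hx := jap_pos x
  have hy : jap y ≤ jap x + h := jap_le_add (by rwa [abs_sub_comm])
  have h2 : jap y ^ r ≤ 2 ^ r * (jap x ^ r + h ^ r) := by
    calc jap y ^ r ≤ (2 * max (jap x) h) ^ r := by
          have := (jap_pos y).le
          gcongr
          linarith [le_max_left (jap x) h, le_max_right (jap x) h]
      _ = 2 ^ r * (max (jap x) h) ^ r := Real.mul_rpow two_pos.le (by positivity)
      _ ≤ 2 ^ r * (jap x ^ r + h ^ r) := by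
          gcongr
          rcases max_cases (jap x) h with ⟨h3, -⟩ | ⟨h3, -⟩ <;> rw [h3]
          · linarith [Real.rpow_nonneg hh r]
          · linarith [Real.rpow_nonneg hx.le r]
  have hxr := Real.rpow_pos_of_pos hx r
  have hyr := Real.rpow_pos_of_pos (jap_pos y) r
  rw [weight, weight, Real.rpow_neg hx.le, Real.rpow_neg (jap_pos y).le]
  field_simp
  exact h2

lemma sq_weight_sub_le {r x y h : ℝ} (hr : 0 ≤ r) (hxy : |x - y| ≤ h) :
    (weight r x - weight r y) ^ 2 ≤
      2 ^ r * (2 + h ^ r * (weight r x + weight r y)) * (weight r x * weight r y) := by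
  have hx := weight_pos r x
  have hy := weight_pos r y
  have h1 := mul_le_mul_of_nonneg_left (weight_le_mul_weight hr hxy) hx.le
  have h2 := mul_le_mul_of_nonneg_left
    (weight_le_mul_weight (x := y) (y := x) hr ((abs_sub_comm y x).trans_le hxy)) hy.le
  nlinarith [mul_pos hx hy]

/-! ### Correlations on the Fourier side -/

lemma integral_fourierChar_smul_fourier_mul (f g : SchwartzMap ℝ ℂ) (h : ℝ) :
    ∫ η, (Real.fourierChar (η * h) • 𝓕 f η) * 𝓕⁻ g η = ∫ x, f (x + h) * g x := by
  have hint : Integrable fun η => Real.fourierChar (η * h) • 𝓕 f η :=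
    (𝓕 f).integrable.mono
      ((Real.continuous_fourierChar.comp (by fun_prop)).smul (𝓕 f).continuous).aestronglyMeasurable
      (.of_forall fun η => (Circle.norm_smul _ _).le)
  have hinv : ∀ x, 𝓕⁻ (fun η => Real.fourierChar (η * h) • 𝓕 f η) x = f (x + h) := fun x => by
    conv_rhs => rw [← FourierTransform.fourierInv_fourier_eq (F := SchwartzMap ℝ ℂ) f]
    rw [SchwartzMap.fourierInv_coe, Real.fourierInv_eq, Real.fourierInv_eq]
    congr 1 with η
    rw [smul_smul, ← AddChar.map_add_eq_mul]
    congr 2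
    simp only [RCLike.inner_apply, conj_trivial]
    ring
  rw [SchwartzMap.fourierInv_coe, ← integral_fourierInv_mul hint g.integrable]
  simp only [hinv]

section Commutator

variable (u : SchwartzMap ℝ ℝ) {w : ℝ → ℝ}

/-- A real Schwartz function multiplied by a real weight, as a complex Schwartz function. -/
noncomputable def weighted (w : ℝ → ℝ) : SchwartzMap ℝ ℂ :=
  SchwartzMap.postcompCLM Complex.ofRealCLM (SchwartzMap.smulLeftCLM ℝ w u)

lemma weighted_apply (hw : w.HasTemperateGrowth) (x : ℝ) :
    weighted u w x = ((w x * u x : ℝ) : ℂ) := by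
  rw [weighted, SchwartzMap.postcompCLM_apply, SchwartzMap.smulLeftCLM_apply_apply hw]
  rfl

/-- The density whose integral against `σ` is half the quadratic form of `[w, [w, σ(D)]]` at `u`,
up to sign. -/
noncomputable def commDensity (w : ℝ → ℝ) (η : ℝ) : ℂ :=
  𝓕 (weighted u w) η * 𝓕⁻ (weighted u w) η
    - 𝓕 (weighted u fun _ => 1) η * 𝓕⁻ (weighted u fun x => w x ^ 2) η

lemma exists_schwartz_commDensity (w : ℝ → ℝ) :
    ∃ k : SchwartzMap ℝ ℂ, ∀ η, k η = commDensity u w η := by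
  obtain ⟨k, hk⟩ := exists_schwartz_mul (𝓕 (weighted u w)) (𝓕⁻ (weighted u w))
  obtain ⟨l, hl⟩ := exists_schwartz_mul (𝓕 (weighted u fun _ => 1))
    (𝓕⁻ (weighted u fun x => w x ^ 2))
  exact ⟨k - l, fun η => by rw [sub_apply, hk, hl, commDensity]⟩

lemma integrable_mul_comp_add (f g : SchwartzMap ℝ ℝ) (h : ℝ) :
    Integrable fun x => f (x + h) * g x := by
  obtain ⟨C, hC⟩ := f.decay 0 0
  refine g.integrable.bdd_mul (c := C)
    (f.continuous.comp (continuous_add_const h)).aestronglyMeasurable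
    (.of_forall fun x => ?_)
  simpa using hC.2 (x + h)

lemma integrable_weighted_mul {w₁ w₂ : ℝ → ℝ} (h₁ : w₁.HasTemperateGrowth)
    (h₂ : w₂.HasTemperateGrowth) (h : ℝ) :
    Integrable fun x => w₁ (x + h) * u (x + h) * (w₂ x * u x) := by
  have := integrable_mul_comp_add (SchwartzMap.smulLeftCLM ℝ w₁ u)
    (SchwartzMap.smulLeftCLM ℝ w₂ u) h
  simpa only [SchwartzMap.smulLeftCLM_apply_apply h₁, SchwartzMap.smulLeftCLM_apply_apply h₂,
    smul_eq_mul] using this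

lemma integral_fourierChar_smul_commDensity (hw : w.HasTemperateGrowth) (h : ℝ) :
    ∫ η, Real.fourierChar (η * h) • commDensity u w η =
      ((∫ x, (w (x + h) * w x - w x ^ 2) * (u (x + h) * u x) : ℝ) : ℂ) := by
  have hint : ∀ f g : SchwartzMap ℝ ℂ,
      Integrable fun η => (Real.fourierChar (η * h) • f η) * g η := fun f g => by
    obtain ⟨k, hk⟩ := exists_schwartz_mul f g
    refine k.integrable.mono (((Real.continuous_fourierChar.comp (by fun_prop)).smul
      f.continuous).mul g.continuous).aestronglyMeasurable (.of_forall fun η => ?_)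
    rw [norm_mul, Circle.norm_smul, hk, norm_mul]
  have hw2 : (fun x => w x ^ 2).HasTemperateGrowth := hw.pow 2
  have h1 : (fun _ : ℝ => (1 : ℝ)).HasTemperateGrowth := .const 1
  have hS : ∀ η, Real.fourierChar (η * h) • commDensity u w η =
      (Real.fourierChar (η * h) • 𝓕 (weighted u w) η) * 𝓕⁻ (weighted u w) η -
      (Real.fourierChar (η * h) • 𝓕 (weighted u fun _ => 1) η) *
        𝓕⁻ (weighted u fun x => w x ^ 2) η := fun η => by
    rw [commDensity, smul_sub, smul_mul_assoc, smul_mul_assoc]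
  simp only [hS]
  rw [integral_sub (hint _ _) (hint _ _), integral_fourierChar_smul_fourier_mul,
    integral_fourierChar_smul_fourier_mul]
  simp only [weighted_apply u hw, weighted_apply u hw2, weighted_apply u h1, ← Complex.ofReal_mul]
  rw [integral_complex_ofReal, integral_complex_ofReal, ← Complex.ofReal_sub]
  rw [← integral_sub (integrable_weighted_mul u hw hw h) (integrable_weighted_mul u h1 hw2 h)]
  congr 2 with x
  ring

lemma integral_one_sub_cos_mul_commDensity (hw : w.HasTemperateGrowth) (h : ℝ) :
    ∫ η, (1 - Real.cos (2 * Real.pi * η * h)) * (commDensity u w η).re =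
      (∫ x, (w x - w (x + h)) ^ 2 * (u x * u (x + h))) / 2 := by
  have hw2 : (fun x => w x ^ 2).HasTemperateGrowth := hw.pow 2
  have h1 : (fun _ : ℝ => (1 : ℝ)).HasTemperateGrowth := .const 1
  have hint : ∀ t : ℝ, Integrable fun η => Real.fourierChar (η * t) • commDensity u w η :=
    fun t => by
    obtain ⟨k, hk⟩ := exists_schwartz_commDensity u w
    simp only [← hk]
    exact k.integrable.mono ((Real.continuous_fourierChar.comp (by fun_prop)).smul
      k.continuous).aestronglyMeasurable (.of_forall fun η => (Circle.norm_smul _ _).le)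
  have hpt : ∀ η, (1 - Real.cos (2 * Real.pi * η * h)) * (commDensity u w η).re =
      (Real.fourierChar (η * 0) • commDensity u w η).re -
        ((Real.fourierChar (η * h) • commDensity u w η).re +
          (Real.fourierChar (η * -h) • commDensity u w η).re) / 2 := fun η => by
    simp only [Circle.smul_def, Real.fourierChar_apply, smul_eq_mul, Complex.mul_re,
      Complex.exp_ofReal_mul_I_re, Complex.exp_ofReal_mul_I_im]
    rw [show 2 * Real.pi * (η * -h) = -(2 * Real.pi * η * h) by ring,
      show 2 * Real.pi * (η * h) = 2 * Real.pi * η * h by ring, Real.cos_neg, Real.sin_neg]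
    simp
    ring
  have hP : ∀ t : ℝ, ∫ η, (Real.fourierChar (η * t) • commDensity u w η).re =
      ∫ x, (w (x + t) * w x - w x ^ 2) * (u (x + t) * u x) := fun t => by
    have := integral_re (hint t)
    simp only [RCLike.re_to_complex] at this
    rw [this, integral_fourierChar_smul_commDensity u hw, Complex.ofReal_re]
  have hre : ∀ t : ℝ, Integrable fun η => (Real.fourierChar (η * t) • commDensity u w η).re :=
    fun t => (hint t).re
  simp only [hpt]
  rw [integral_sub (hre 0) (((hre h).fun_add (hre (-h))).div_const 2), integral_div,
    integral_add (hre h) (hre (-h)), hP, hP, hP]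
  have hzero : ∫ x, (w (x + 0) * w x - w x ^ 2) * (u (x + 0) * u x) = 0 := by
    refine integral_eq_zero_of_ae (.of_forall fun x => ?_)
    simp only [add_zero, Pi.zero_apply]
    ring
  have hshift : ∫ x, (w (x + -h) * w x - w x ^ 2) * (u (x + -h) * u x) =
      ∫ x, (w x * w (x + h) - w (x + h) ^ 2) * (u x * u (x + h)) := by
    rw [← integral_add_right_eq_self _ h]
    simp only [add_neg_cancel_right]
  have hi1 : Integrable fun x => (w (x + h) * w x - w x ^ 2) * (u (x + h) * u x) := by
    refine ((integrable_weighted_mul u hw hw h).sub (integrable_weighted_mul u h1 hw2 h)).congr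
      (.of_forall fun x => ?_)
    simp only [Pi.sub_apply]
    ring
  have hi2 : Integrable fun x => (w x * w (x + h) - w (x + h) ^ 2) * (u x * u (x + h)) := by
    refine ((integrable_weighted_mul u hw hw h).sub (integrable_weighted_mul u hw2 h1 h)).congr
      (.of_forall fun x => ?_)
    simp only [Pi.sub_apply]
    ring
  rw [hzero, hshift, ← integral_add hi1 hi2, zero_sub, ← neg_div, ← integral_neg]
  congr 2 with x
  ring

end Commutator

/-! ### The symbol as a superposition of `1 - cos` -/

lemma integrableOn_one_sub_cos_mul_rpow {α : ℝ} (h0 : 0 < α) (h2 : α < 2) :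
    IntegrableOn (fun t : ℝ => (1 - Real.cos t) * t ^ (-1 - α)) (Ioi 0) := by
  have hmeas : Measurable fun t : ℝ => (1 - Real.cos t) * t ^ (-1 - α) := by fun_prop
  rw [← Ioc_union_Ioi_eq_Ioi zero_le_one]
  refine IntegrableOn.union ?_ ?_
  · have hi : IntegrableOn (fun t : ℝ => t ^ (1 - α)) (Ioc 0 1) :=
      (intervalIntegrable_iff_integrableOn_Ioc_of_le zero_le_one).1
        (intervalIntegral.intervalIntegrable_rpow' (by linarith))
    refine hi.mono' hmeas.aestronglyMeasurable
      (ae_restrict_of_forall_mem measurableSet_Ioc fun t ht => ?_)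
    have ht0 : 0 < t := ht.1
    rw [Real.norm_of_nonneg (mul_nonneg (by linarith [Real.cos_le_one t]) (by positivity))]
    calc (1 - Real.cos t) * t ^ (-1 - α) ≤ t ^ (2 : ℝ) * t ^ (-1 - α) := by
          gcongr
          rw [Real.rpow_two]
          nlinarith [Real.one_sub_sq_div_two_le_cos (x := t)]
      _ = t ^ (1 - α) := by
          rw [← Real.rpow_add ht0]
          congr 1
          ring
  · have hi : IntegrableOn (fun t : ℝ => 2 * t ^ (-1 - α)) (Ioi 1) :=
      (integrableOn_Ioi_rpow_of_lt (by linarith) one_pos).const_mul 2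
    refine hi.mono' hmeas.aestronglyMeasurable
      (ae_restrict_of_forall_mem measurableSet_Ioi fun t ht => ?_)
    have ht0 : 0 < t := one_pos.trans ht
    rw [Real.norm_of_nonneg (mul_nonneg (by linarith [Real.cos_le_one t]) (by positivity))]
    gcongr
    linarith [Real.neg_one_le_cos t]

/-- The normalising constant `∫₀^∞ (1 - cos t) t^{-1-α} dt`. -/
noncomputable def levyConst (α : ℝ) : ℝ := ∫ t in Ioi (0 : ℝ), (1 - Real.cos t) * t ^ (-1 - α)

lemma levyConst_pos {α : ℝ} (h0 : 0 < α) (h2 : α < 2) : 0 < levyConst α := by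
  rw [levyConst, setIntegral_pos_iff_support_of_nonneg_ae _
    (integrableOn_one_sub_cos_mul_rpow h0 h2)]
  · refine lt_of_lt_of_le ?_ (measure_mono (s := Ioo (0 : ℝ) 1) fun t ht => ?_)
    · simp
    · refine ⟨ne_of_gt (mul_pos ?_ (Real.rpow_pos_of_pos ht.1 _)), ht.1⟩
      have := Real.cos_lt_cos_of_nonneg_of_le_pi_div_two le_rfl
        (by linarith [ht.2, Real.pi_gt_three]) ht.1
      rw [Real.cos_zero] at this
      linarith
  · exact ae_restrict_of_forall_mem measurableSet_Ioi fun t ht =>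
      mul_nonneg (by linarith [Real.cos_le_one t]) (Real.rpow_nonneg (le_of_lt ht) _)

lemma one_sub_cos_comp_mul {α s h : ℝ} (hs : 0 < s) (hh : 0 < h) :
    (1 - Real.cos (s * h)) * h ^ (-1 - α) =
      s ^ (1 + α) * ((1 - Real.cos (s * h)) * (s * h) ^ (-1 - α)) := by
  rw [Real.mul_rpow hs.le hh.le]
  have : s ^ (1 + α) * s ^ (-1 - α) = 1 := by
    rw [← Real.rpow_add hs, show 1 + α + (-1 - α) = 0 by ring, Real.rpow_zero]
  linear_combination (-(1 - Real.cos (s * h)) * h ^ (-1 - α)) * this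

lemma integrableOn_one_sub_cos_mul_symbol {α : ℝ} (h0 : 0 < α) (h2 : α < 2) (η : ℝ) :
    IntegrableOn (fun h : ℝ => (1 - Real.cos (2 * Real.pi * η * h)) * h ^ (-1 - α)) (Ioi 0) := by
  rcases eq_or_ne η 0 with rfl | hη
  · simp
  have hs : 0 < |2 * Real.pi * η| := by positivity
  have hi := (integrableOn_Ioi_comp_mul_left_iff (fun t => (1 - Real.cos t) * t ^ (-1 - α)) 0 hs).2
    (by simpa using integrableOn_one_sub_cos_mul_rpow h0 h2)
  refine IntegrableOn.congr_fun (Integrable.const_mul hi (|2 * Real.pi * η| ^ (1 + α)))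
    (fun h hh => ?_) measurableSet_Ioi
  rw [← one_sub_cos_comp_mul hs hh, ← Real.cos_abs (2 * Real.pi * η * h),
    abs_mul _ h, abs_of_pos (show 0 < h from hh)]

lemma integral_one_sub_cos_mul_symbol {α : ℝ} (h0 : 0 < α) (η : ℝ) :
    ∫ h in Ioi (0 : ℝ), (1 - Real.cos (2 * Real.pi * η * h)) * h ^ (-1 - α) =
      levyConst α * fracSymbol α η := by
  rcases eq_or_ne η 0 with rfl | hη
  · simp [fracSymbol, Real.zero_rpow h0.ne']
  have hs : 0 < |2 * Real.pi * η| := by positivity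
  rw [setIntegral_congr_fun (g := fun h => |2 * Real.pi * η| ^ (1 + α) *
    ((1 - Real.cos (|2 * Real.pi * η| * h)) * (|2 * Real.pi * η| * h) ^ (-1 - α)))
    measurableSet_Ioi fun h hh => ?_]
  · rw [integral_const_mul,
      integral_comp_mul_left_Ioi (fun t => (1 - Real.cos t) * t ^ (-1 - α)) 0 hs, mul_zero,
      smul_eq_mul, ← mul_assoc, ← levyConst, fracSymbol, mul_comm (levyConst α),
      Real.rpow_add hs, Real.rpow_one]
    field_simp
  · simp only
    rw [← one_sub_cos_comp_mul hs hh, ← Real.cos_abs (2 * Real.pi * η * h), abs_mul,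
      abs_of_pos (show 0 < h from hh)]

section Superposition

variable {α : ℝ} {T : ℝ → ℝ}

lemma integrable_superposition (h0 : 0 < α) (h2 : α < 2) (hT : Continuous T)
    (hσT : Integrable fun η => fracSymbol α η * T η) :
    Integrable (fun p : ℝ × ℝ => (1 - Real.cos (2 * Real.pi * p.1 * p.2)) * p.2 ^ (-1 - α) * T p.1)
      (volume.prod (volume.restrict (Ioi 0))) := by
  have hmeas : Measurable fun p : ℝ × ℝ =>
      (1 - Real.cos (2 * Real.pi * p.1 * p.2)) * p.2 ^ (-1 - α) * T p.1 := by
    have := hT.measurable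
    fun_prop
  rw [integrable_prod_iff hmeas.aestronglyMeasurable]
  refine ⟨.of_forall fun η =>
    Integrable.mul_const (integrableOn_one_sub_cos_mul_symbol h0 h2 η) (T η), ?_⟩
  refine (hσT.norm.const_mul (levyConst α)).congr (.of_forall fun η => ?_)
  simp only [norm_mul _ (T η)]
  rw [integral_mul_const, setIntegral_congr_fun
    (g := fun h => (1 - Real.cos (2 * Real.pi * η * h)) * h ^ (-1 - α)) measurableSet_Ioi fun h hh =>
      Real.norm_of_nonneg (mul_nonneg (by linarith [Real.cos_le_one (2 * Real.pi * η * h)])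
        (Real.rpow_nonneg (le_of_lt hh) _)),
    integral_one_sub_cos_mul_symbol h0, Real.norm_of_nonneg (fracSymbol_nonneg α η)]
  ring

lemma integrableOn_rpow_mul_integral_one_sub_cos (h0 : 0 < α) (h2 : α < 2) (hT : Continuous T)
    (hσT : Integrable fun η => fracSymbol α η * T η) :
    IntegrableOn
      (fun h => h ^ (-1 - α) * ∫ η, (1 - Real.cos (2 * Real.pi * η * h)) * T η) (Ioi 0) := by
  refine (integrable_superposition h0 h2 hT hσT).integral_prod_right.congr (.of_forall fun h => ?_)
  simp only
  rw [← integral_const_mul]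
  congr 1 with η
  ring

lemma levyConst_mul_integral_fracSymbol_mul (h0 : 0 < α) (h2 : α < 2) (hT : Continuous T)
    (hσT : Integrable fun η => fracSymbol α η * T η) :
    levyConst α * ∫ η, fracSymbol α η * T η =
      ∫ h in Ioi 0, h ^ (-1 - α) * ∫ η, (1 - Real.cos (2 * Real.pi * η * h)) * T η := by
  have hswap := integral_integral_swap
    (f := fun η h => (1 - Real.cos (2 * Real.pi * η * h)) * h ^ (-1 - α) * T η)
    (integrable_superposition h0 h2 hT hσT)
  calc levyConst α * ∫ η, fracSymbol α η * T η
      = ∫ η, ∫ h in Ioi 0, (1 - Real.cos (2 * Real.pi * η * h)) * h ^ (-1 - α) * T η := by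
        rw [← integral_const_mul]
        congr 1 with η
        rw [integral_mul_const, integral_one_sub_cos_mul_symbol h0, mul_assoc]
    _ = ∫ h in Ioi 0, ∫ η, (1 - Real.cos (2 * Real.pi * η * h)) * h ^ (-1 - α) * T η := hswap
    _ = _ := by
        congr 1 with h
        rw [← integral_const_mul]
        congr 1 with η
        ring

/-- The symbol `ξ²` is the limit of rescaled second differences. -/
lemma tendsto_integral_one_sub_cos (hT : Continuous T)
    (hσT : Integrable fun η => fracSymbol 2 η * T η) :
    Tendsto (fun n : ℕ => 2 / (1 / ((n : ℝ) + 1)) ^ 2 *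
        ∫ η, (1 - Real.cos (2 * Real.pi * η * (1 / ((n : ℝ) + 1)))) * T η)
      atTop (𝓝 (∫ η, fracSymbol 2 η * T η)) := by
  have hlim : Tendsto (fun n : ℕ => 1 / ((n : ℝ) + 1)) atTop (𝓝[≠] 0) :=
    tendsto_nhdsWithin_iff.2 ⟨tendsto_one_div_add_atTop_nhds_zero_nat,
      .of_forall fun n => (by positivity : (0 : ℝ) < 1 / ((n : ℝ) + 1)).ne'⟩
  have hsq : ∀ η h : ℝ, 2 / h ^ 2 * (1 - Real.cos (2 * Real.pi * η * h)) =
      (2 * (h⁻¹ * Real.sin (Real.pi * η * h))) ^ 2 := fun η h => by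
    rw [show 2 * Real.pi * η * h = 2 * (Real.pi * η * h) by ring, Real.cos_two_mul, Real.cos_sq']
    ring
  have hpt : ∀ η : ℝ, Tendsto (fun h : ℝ => 2 / h ^ 2 * (1 - Real.cos (2 * Real.pi * η * h)))
      (𝓝[≠] 0) (𝓝 (fracSymbol 2 η)) := fun η => by
    have hd : HasDerivAt (fun h => Real.sin (Real.pi * η * h)) (Real.pi * η) 0 := by
      simpa using ((hasDerivAt_id (0 : ℝ)).const_mul (Real.pi * η)).sin
    have := (hd.tendsto_slope_zero.const_mul 2).pow 2
    simp only [zero_add, mul_zero, Real.sin_zero, sub_zero, smul_eq_mul] at this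
    simp only [hsq, fracSymbol, Real.rpow_two, sq_abs]
    rwa [mul_assoc]
  simp only [← integral_const_mul]
  refine tendsto_integral_of_dominated_convergence (fun η => ‖fracSymbol 2 η * T η‖)
    (fun n => (by fun_prop : Continuous _).aestronglyMeasurable) hσT.norm
    (fun n => .of_forall fun η => ?_) (.of_forall fun η => ?_)
  · have hn : (0 : ℝ) < 1 / ((n : ℝ) + 1) := by positivity
    generalize 1 / ((n : ℝ) + 1) = h at hn
    rw [← mul_assoc, norm_mul _ (T η), norm_mul _ (T η), Real.norm_of_nonneg (fracSymbol_nonneg 2 η), hsq,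
      Real.norm_of_nonneg (sq_nonneg _), fracSymbol, Real.rpow_two]
    refine mul_le_mul_of_nonneg_right ?_ (norm_nonneg _)
    rw [sq_le_sq, abs_abs, abs_mul, abs_mul, abs_of_pos (inv_pos.2 hn)]
    have := Real.abs_sin_le_abs (x := Real.pi * η * h)
    rw [abs_mul _ h, abs_of_pos hn] at this
    rw [abs_two, mul_assoc 2 Real.pi, abs_mul 2, abs_two, inv_mul_eq_div]
    gcongr
    rwa [div_le_iff₀ hn]
  · simp only [← mul_assoc]
    exact ((hpt η).comp hlim).mul_const (T η)

end Superposition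

/-! ### Bounds for the weighted differences -/

section Bounds

variable {r : ℝ} (u : SchwartzMap ℝ ℝ)

lemma integrable_sq_weight_mul (r : ℝ) : Integrable fun x => (weight r x * u x) ^ 2 := by
  refine (integrable_weighted_mul u (hasTemperateGrowth_weight r) (hasTemperateGrowth_weight r)
    0).congr (.of_forall fun x => ?_)
  simp only [add_zero]
  ring

lemma integrable_sq_weight_mul_mul_comp_add (r h : ℝ) :
    Integrable fun x => (weight r x * u x) ^ 2 * (weight r (x + h) * u (x + h)) ^ 2 := by
  obtain ⟨C, hC⟩ := (SchwartzMap.smulLeftCLM ℝ (weight r) u).decay 0 0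
  have hv : ∀ x, |weight r x * u x| ≤ C := fun x => by
    simpa [SchwartzMap.smulLeftCLM_apply_apply (hasTemperateGrowth_weight r)] using hC.2 x
  refine ((integrable_sq_weight_mul u r).comp_add_right h).bdd_mul (c := C ^ 2)
    (((continuous_weight r).mul u.continuous).pow 2).aestronglyMeasurable
    (.of_forall fun x => ?_)
  rw [norm_pow, Real.norm_eq_abs]
  gcongr
  exact hv x

lemma integral_sq_weight_sub_mul_le_of_le_one (hr : 0 ≤ r) (hr2 : r ≤ 2) {h : ℝ} (h0 : 0 ≤ h)
    (h1 : h ≤ 1) :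
    ∫ x, (weight r x - weight r (x + h)) ^ 2 * (u x * u (x + h)) ≤
      9 * h ^ 2 * ∫ x, (weight r x * u x) ^ 2 := by
  have hq := integrable_sq_weight_mul u r
  have hb := norm_integral_le_of_norm_le
    (f := fun x => (weight r x - weight r (x + h)) ^ 2 * (u x * u (x + h)))
    ((hq.fun_add (hq.comp_add_right h)).const_mul (9 / 2 * h ^ 2)) (.of_forall fun x => by
      have hd := sq_weight_sub_le_of_le_one (x := x) (y := x + h) hr hr2
        (by simp [abs_of_nonneg h0]) h1
      have hw := weight_pos r x
      have hw' := weight_pos r (x + h)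
      calc ‖(weight r x - weight r (x + h)) ^ 2 * (u x * u (x + h))‖
          = (weight r x - weight r (x + h)) ^ 2 * (|u x| * |u (x + h)|) := by
            rw [Real.norm_eq_abs, abs_mul, abs_mul, abs_of_nonneg (sq_nonneg _)]
        _ ≤ 9 * h ^ 2 * (weight r x * weight r (x + h)) * (|u x| * |u (x + h)|) := by gcongr
        _ = 9 / 2 * h ^ 2 *
              (2 * (weight r x * |u x|) * (weight r (x + h) * |u (x + h)|)) := by ring
        _ ≤ 9 / 2 * h ^ 2 *
              ((weight r x * |u x|) ^ 2 + (weight r (x + h) * |u (x + h)|) ^ 2) := by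
            gcongr
            exact two_mul_le_add_sq _ _
        _ = _ := by simp only [mul_pow, sq_abs])
  refine (le_abs_self _).trans (hb.trans_eq ?_)
  rw [integral_const_mul, integral_add hq (hq.comp_add_right h),
    integral_add_right_eq_self (fun x => (weight r x * u x) ^ 2) h]
  ring

lemma mul_le_of_le_mul_add {A H c d w z a b : ℝ} (hA : 0 < A) (hc : 0 ≤ c) (ha : 0 ≤ a) (hb : 0 ≤ b) (hd : d ≤ c * (2 + H * (w + z)) * (w * z)) :
    d * (a * b) ≤ c * (w ^ 2 * a ^ 2 + z ^ 2 * b ^ 2 + A * H ^ 2 * (w ^ 2 + z ^ 2) +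
      w ^ 2 * a ^ 2 * (z ^ 2 * b ^ 2) / (2 * A)) := by
  set s := w * a * (z * b) with hs
  have hyoung : H * (w + z) * s ≤ A * H ^ 2 * (w ^ 2 + z ^ 2) + s ^ 2 / (2 * A) := by
    have h1 : A * (H * (w + z)) ^ 2 / 2 + s ^ 2 / (2 * A) - H * (w + z) * s =
        (A * (H * (w + z)) - s) ^ 2 / (2 * A) := by
      field_simp
      ring
    have h2 : 0 ≤ (A * (H * (w + z)) - s) ^ 2 / (2 * A) := by positivity
    nlinarith [mul_nonneg hA.le (sq_nonneg (H * (w - z)))]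
  calc d * (a * b) ≤ c * (2 + H * (w + z)) * (w * z) * (a * b) := by gcongr
    _ = c * (2 * (w * a) * (z * b) + H * (w + z) * s) := by rw [hs]; ring
    _ ≤ c * ((w * a) ^ 2 + (z * b) ^ 2 +
          (A * H ^ 2 * (w ^ 2 + z ^ 2) + s ^ 2 / (2 * A))) := by
        gcongr
        exact two_mul_le_add_sq _ _
    _ = _ := by rw [hs]; ring

lemma integral_sq_weight_sub_mul_le (hr : 1 / 2 < r) {h A : ℝ} (h0 : 0 ≤ h) (hA : 0 < A) :
    ∫ x, (weight r x - weight r (x + h)) ^ 2 * (u x * u (x + h)) ≤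
      2 ^ r * (2 * (∫ x, (weight r x * u x) ^ 2) + 2 * A * (h ^ r) ^ 2 * (∫ x, weight r x ^ 2) +
        (∫ x, (weight r x * u x) ^ 2 * (weight r (x + h) * u (x + h)) ^ 2) / (2 * A)) := by
  have hq := integrable_sq_weight_mul u r
  have hw2 := integrable_weight_sq hr
  have hG := integrable_sq_weight_mul_mul_comp_add u r h
  have hb := norm_integral_le_of_norm_le
    (f := fun x => (weight r x - weight r (x + h)) ^ 2 * (u x * u (x + h)))
    ((((hq.fun_add (hq.comp_add_right h)).fun_add
      ((hw2.fun_add (hw2.comp_add_right h)).const_mul (A * (h ^ r) ^ 2))).fun_add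
        (hG.div_const (2 * A))).const_mul (2 ^ r)) (.of_forall fun x => by
      have hd := sq_weight_sub_le (r := r) (x := x) (y := x + h) (h := h) (by linarith)
        (by simp [abs_of_nonneg h0])
      rw [Real.norm_eq_abs, abs_mul, abs_mul, abs_of_nonneg (sq_nonneg _)]
      simp only [mul_pow]
      rw [← sq_abs (u x), ← sq_abs (u (x + h))]
      exact mul_le_of_le_mul_add hA (by positivity) (abs_nonneg _) (abs_nonneg _) hd)
  refine (le_abs_self _).trans (hb.trans_eq ?_)
  rw [integral_const_mul, integral_add ((hq.fun_add (hq.comp_add_right h)).fun_add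
      ((hw2.fun_add (hw2.comp_add_right h)).const_mul (A * (h ^ r) ^ 2))) (hG.div_const (2 * A)),
    integral_add (hq.fun_add (hq.comp_add_right h))
      ((hw2.fun_add (hw2.comp_add_right h)).const_mul (A * (h ^ r) ^ 2)),
    integral_const_mul, integral_div, integral_add hq (hq.comp_add_right h),
    integral_add hw2 (hw2.comp_add_right h),
    integral_add_right_eq_self (fun x => (weight r x * u x) ^ 2) h,
    integral_add_right_eq_self (fun x => weight r x ^ 2) h]
  ring

end Bounds

section Correlation

variable {q : ℝ → ℝ}

lemma integrable_correlation (hq : Integrable q) :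
    Integrable (fun p : ℝ × ℝ => q p.1 * q (p.1 + p.2)) :=
  (measurePreserving_prod_add volume volume).integrable_comp_of_integrable (hq.mul_prod hq)

lemma integral_correlation (hq : Integrable q) :
    ∫ h, ∫ x, q x * q (x + h) = (∫ x, q x) ^ 2 := by
  rw [← integral_integral_swap (f := fun x h => q x * q (x + h)) (integrable_correlation hq)]
  simp only [integral_const_mul, integral_add_left_eq_self q]
  rw [integral_mul_const, sq]

lemma setIntegral_correlation_le (hq : Integrable q) (hq0 : 0 ≤ q) (s : Set ℝ) :
    ∫ h in s, ∫ x, q x * q (x + h) ≤ (∫ x, q x) ^ 2 := by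
  rw [← integral_correlation hq]
  exact setIntegral_le_integral (integrable_correlation hq).integral_prod_right
    (.of_forall fun h => integral_nonneg fun x => mul_nonneg (hq0 x) (hq0 _))

end Correlation

/-! ### The commutator estimate -/

section Estimate

variable {α r : ℝ} (u : SchwartzMap ℝ ℝ)

lemma continuous_re_commDensity (w : ℝ → ℝ) : Continuous fun η => (commDensity u w η).re := by
  obtain ⟨k, hk⟩ := exists_schwartz_commDensity u w
  simp only [← hk]
  exact Complex.continuous_re.comp k.continuous

lemma integrable_fracSymbol_mul_re_commDensity (ha : 0 ≤ α) (w : ℝ → ℝ) :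
    Integrable fun η => fracSymbol α η * (commDensity u w η).re := by
  obtain ⟨k, hk⟩ := exists_schwartz_commDensity u w
  simp only [← hk]
  refine (integrable_fracSymbol_mul ha k).re.congr (.of_forall fun η => ?_)
  exact Complex.re_ofReal_mul _ _

lemma integral_fracSymbol_two_mul_commDensity_le (hr : 0 ≤ r) (hr2 : r ≤ 2) :
    ∫ η, fracSymbol 2 η * (commDensity u (weight r) η).re ≤
      9 * ∫ x, (weight r x * u x) ^ 2 := by
  refine le_of_tendsto' (tendsto_integral_one_sub_cos (continuous_re_commDensity u _)
    (integrable_fracSymbol_mul_re_commDensity u zero_le_two _)) fun n => ?_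
  have hn : (0 : ℝ) < 1 / ((n : ℝ) + 1) := by positivity
  have hn1 : 1 / ((n : ℝ) + 1) ≤ 1 := by
    rw [div_le_one (by positivity)]
    linarith [n.cast_nonneg (α := ℝ)]
  generalize 1 / ((n : ℝ) + 1) = h at hn hn1
  rw [integral_one_sub_cos_mul_commDensity u (hasTemperateGrowth_weight r), div_mul_div_comm,
    div_le_iff₀ (by positivity)]
  linarith [integral_sq_weight_sub_mul_le_of_le_one u hr hr2 hn.le hn1]

lemma levyConst_mul_integral_fracSymbol_mul_commDensity_le (h0 : 0 < α) (h2 : α < 2)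
    (hr : 1 / 2 < r) (hrα : r < α + 1 / 2) (hr2 : r ≤ 2) {M : ℝ}
    (hM : ∫ x, (weight r x * u x) ^ 2 < M) :
    levyConst α * ∫ η, fracSymbol α η * (commDensity u (weight r) η).re ≤
      (9 / 2 * (∫ h in Ioc (0 : ℝ) 1, h ^ (1 - α)) +
        2 ^ r * ((∫ h in Ioi (1 : ℝ), h ^ (-1 - α)) +
          (∫ x, weight r x ^ 2) * (∫ h in Ioi (1 : ℝ), h ^ (2 * (r - 1 - α))) + 1 / 4)) * M := by
  set N := ∫ x, (weight r x * u x) ^ 2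
  set J := ∫ x, weight r x ^ 2
  set G : ℝ → ℝ := fun h =>
    ∫ x, (weight r x * u x) ^ 2 * (weight r (x + h) * u (x + h)) ^ 2
  have hN0 : 0 ≤ N := integral_nonneg fun x => sq_nonneg _
  have hJ0 : 0 ≤ J := integral_nonneg fun x => sq_nonneg _
  have hM0 : 0 < M := hN0.trans_lt hM
  have hq := integrable_sq_weight_mul u r
  have hGint : Integrable G := (integrable_correlation hq).integral_prod_right
  have hGle : ∫ h in Ioi (1 : ℝ), G h ≤ N ^ 2 :=
    setIntegral_correlation_le hq (fun x => sq_nonneg _) _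
  have hσ := integrable_fracSymbol_mul_re_commDensity u h0.le (weight r)
  have hF := integrableOn_rpow_mul_integral_one_sub_cos h0 h2
    (continuous_re_commDensity u (weight r)) hσ
  rw [levyConst_mul_integral_fracSymbol_mul h0 h2 (continuous_re_commDensity u (weight r)) hσ]
  simp only [integral_one_sub_cos_mul_commDensity u (hasTemperateGrowth_weight r)] at hF ⊢
  have hF0 := hF.mono_set (Ioc_subset_Ioi_self : Ioc (0 : ℝ) 1 ⊆ Ioi 0)
  have hF1 := hF.mono_set (Ioi_subset_Ioi (zero_le_one' ℝ))
  rw [← Ioc_union_Ioi_eq_Ioi (zero_le_one' ℝ), setIntegral_union Ioc_disjoint_Ioi_same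
    measurableSet_Ioi hF0 hF1]
  have hi0 : IntegrableOn (fun h : ℝ => h ^ (1 - α)) (Ioc 0 1) :=
    (intervalIntegrable_iff_integrableOn_Ioc_of_le zero_le_one).1
      (intervalIntegral.intervalIntegrable_rpow' (by linarith))
  have hi1 : IntegrableOn (fun h : ℝ => h ^ (-1 - α)) (Ioi 1) :=
    integrableOn_Ioi_rpow_of_lt (by linarith) one_pos
  have hi2 : IntegrableOn (fun h : ℝ => h ^ (2 * (r - 1 - α))) (Ioi 1) :=
    integrableOn_Ioi_rpow_of_lt (by linarith) one_pos
  have hnear : ∫ h in Ioc (0 : ℝ) 1, h ^ (-1 - α) *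
      ((∫ x, (weight r x - weight r (x + h)) ^ 2 * (u x * u (x + h))) / 2) ≤
      9 / 2 * N * ∫ h in Ioc (0 : ℝ) 1, h ^ (1 - α) := by
    rw [← integral_const_mul]
    refine setIntegral_mono_on hF0 (Integrable.const_mul hi0 _) measurableSet_Ioc fun h hh => ?_
    have hh0 : 0 < h := hh.1
    calc _ ≤ h ^ (-1 - α) * (9 * h ^ 2 * N / 2) := by
          gcongr
          exact integral_sq_weight_sub_mul_le_of_le_one u (by linarith) hr2 hh0.le hh.2
      _ = 9 / 2 * N * (h ^ (-1 - α) * h ^ (2 : ℝ)) := by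
          rw [Real.rpow_two]
          ring
      _ = 9 / 2 * N * h ^ (1 - α) := by
          rw [← Real.rpow_add hh0]
          ring_nf
  have hfar : ∫ h in Ioi (1 : ℝ), h ^ (-1 - α) *
      ((∫ x, (weight r x - weight r (x + h)) ^ 2 * (u x * u (x + h))) / 2) ≤
      2 ^ r * (N * (∫ h in Ioi (1 : ℝ), h ^ (-1 - α)) +
        M * J * (∫ h in Ioi (1 : ℝ), h ^ (2 * (r - 1 - α))) +
        1 / (4 * M) * ∫ h in Ioi (1 : ℝ), G h) := by
    have e1 := Integrable.const_mul hi1 N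
    have e2 := Integrable.const_mul hi2 (M * J)
    have e3 := Integrable.const_mul (hGint.integrableOn (s := Ioi (1 : ℝ))) (1 / (4 * M))
    rw [← integral_const_mul N, ← integral_const_mul (M * J), ← integral_const_mul (1 / (4 * M)),
      ← integral_add e1 e2, ← integral_add (e1.fun_add e2) e3, ← integral_const_mul]
    refine setIntegral_mono_on hF1 (((e1.fun_add e2).fun_add e3).const_mul _)
      measurableSet_Ioi fun h hh => ?_
    have hh0 : 0 < h := one_pos.trans hh
    have hp := Real.rpow_pos_of_pos hh0 (-1 - α)
    have hexp : h ^ (2 * (r - 1 - α)) = (h ^ (-1 - α)) ^ 2 * (h ^ r) ^ 2 := by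
      rw [← mul_pow, ← Real.rpow_add hh0, ← Real.rpow_natCast, ← Real.rpow_mul hh0.le]
      congr 1
      push_cast
      ring
    have hB := integral_sq_weight_sub_mul_le u hr hh0.le (mul_pos hM0 hp)
    calc _ ≤ h ^ (-1 - α) * (2 ^ r * (2 * N + 2 * (M * h ^ (-1 - α)) * (h ^ r) ^ 2 * J +
          G h / (2 * (M * h ^ (-1 - α)))) / 2) := by gcongr
      _ = _ := by
          rw [hexp]
          field_simp
          ring
  have hG2 : 1 / (4 * M) * (∫ h in Ioi (1 : ℝ), G h) ≤ 1 / 4 * M := by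
    calc _ ≤ 1 / (4 * M) * M ^ 2 := by
          gcongr
          exact hGle.trans (by gcongr)
      _ = _ := by
          field_simp
  have ha : 0 ≤ ∫ h in Ioc (0 : ℝ) 1, h ^ (1 - α) :=
    setIntegral_nonneg measurableSet_Ioc fun h hh => Real.rpow_nonneg (le_of_lt hh.1) _
  have hb : 0 ≤ ∫ h in Ioi (1 : ℝ), h ^ (-1 - α) :=
    setIntegral_nonneg measurableSet_Ioi fun h hh =>
      Real.rpow_nonneg (zero_le_one.trans (le_of_lt hh)) _
  calc _ ≤ 9 / 2 * M * (∫ h in Ioc (0 : ℝ) 1, h ^ (1 - α)) +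
        2 ^ r * (M * (∫ h in Ioi (1 : ℝ), h ^ (-1 - α)) +
        M * J * (∫ h in Ioi (1 : ℝ), h ^ (2 * (r - 1 - α))) + 1 / 4 * M) := by
        refine add_le_add (hnear.trans ?_) (hfar.trans ?_)
        · gcongr
        · gcongr
    _ = _ := by ring

/-- The quadratic form of `[w, [w, |D|^α]]`, `w = ⟨x⟩^{-r}`, is bounded by `‖w u‖²`. -/
lemma exists_integral_fracSymbol_mul_commDensity_le (h0 : 0 < α) (h2 : α ≤ 2)
    (hr : 1 / 2 < r) (hrα : r < α + 1 / 2) (hr2 : r ≤ 2) :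
    ∃ C : ℝ, 0 < C ∧ ∀ u : SchwartzMap ℝ ℝ,
      ∫ η, fracSymbol α η * (commDensity u (weight r) η).re ≤
        C * ∫ x, (weight r x * u x) ^ 2 := by
  rcases h2.eq_or_lt with rfl | h2
  · exact ⟨9, by norm_num, fun u =>
      integral_fracSymbol_two_mul_commDensity_le u (by linarith) hr2⟩
  have hc := levyConst_pos h0 h2
  set K := 9 / 2 * (∫ h in Ioc (0 : ℝ) 1, h ^ (1 - α)) +
    2 ^ r * ((∫ h in Ioi (1 : ℝ), h ^ (-1 - α)) +
      (∫ x, weight r x ^ 2) * (∫ h in Ioi (1 : ℝ), h ^ (2 * (r - 1 - α))) + 1 / 4)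
  have hK0 : 0 < K := by
    have ha : 0 ≤ ∫ h in Ioc (0 : ℝ) 1, h ^ (1 - α) :=
      setIntegral_nonneg measurableSet_Ioc fun h hh => Real.rpow_nonneg (le_of_lt hh.1) _
    have hb : ∀ s : ℝ, 0 ≤ ∫ h in Ioi (1 : ℝ), h ^ s := fun s =>
      setIntegral_nonneg measurableSet_Ioi fun h hh =>
        Real.rpow_nonneg (zero_le_one.trans (le_of_lt hh)) _
    have hJ0 : 0 ≤ ∫ x, weight r x ^ 2 := integral_nonneg fun x => sq_nonneg _
    have := hb (-1 - α)
    have := hb (2 * (r - 1 - α))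
    positivity
  refine ⟨K / levyConst α, div_pos hK0 hc, fun u => ?_⟩
  rw [div_mul_eq_mul_div, le_div_iff₀' hc, ← div_le_iff₀' hK0]
  refine le_of_forall_gt_imp_ge_of_dense fun M hM => ?_
  rw [div_le_iff₀' hK0]
  exact levyConst_mul_integral_fracSymbol_mul_commDensity_le u h0 h2 hr hrα hr2 hM

end Estimate

/-! ### The weighted inequality -/

section Main

variable (u : SchwartzMap ℝ ℝ) {w : ℝ → ℝ}

lemma fourier_mul_fourierInv_weighted (hw : w.HasTemperateGrowth) (η : ℝ) :
    𝓕 (weighted u w) η * 𝓕⁻ (weighted u w) η = ((‖𝓕 (weighted u w) η‖ ^ 2 : ℝ) : ℂ) := by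
  have hconj : 𝓕⁻ (weighted u w) η = conj (𝓕 (weighted u w) η) := by
    rw [SchwartzMap.fourierInv_coe, SchwartzMap.fourier_coe, Real.fourierInv_eq,
      Real.fourier_eq, ← integral_conj]
    congr 1 with x
    rw [weighted_apply u hw, Circle.smul_def, Circle.smul_def, smul_eq_mul, smul_eq_mul, map_mul,
      Complex.conj_ofReal, AddChar.map_neg_eq_inv, Circle.coe_inv_eq_conj, Complex.conj_conj]
  rw [hconj, Complex.mul_conj, Complex.normSq_eq_norm_sq]

lemma fracSymbol_half_sq (a η : ℝ) : fracSymbol (a / 2) η ^ 2 = fracSymbol a η := by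
  rw [fracSymbol, fracSymbol, ← Real.rpow_natCast, ← Real.rpow_mul (abs_nonneg _)]
  congr 1
  push_cast
  ring

lemma re_integral_neg_fracD_mul_le {a : ℝ} (ha : 0 ≤ a) (hw : w.HasTemperateGrowth) :
    (∫ x, -(fracD a (weighted u fun _ => 1) x) * weighted u (fun x => w x ^ 2) x).re ≤
      -(∫ x, ‖fracD (a / 2) (weighted u w) x‖ ^ 2) +
        ∫ η, fracSymbol a η * (commDensity u w η).re := by
  have hi : ∀ f g : SchwartzMap ℝ ℂ, Integrable fun η => (fracSymbol a η : ℂ) * (f η * g η) :=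
    fun f g => by
    obtain ⟨k, hk⟩ := exists_schwartz_mul f g
    simpa only [hk] using integrable_fracSymbol_mul ha k
  have h1 : ∫ x, fracD a (weighted u fun _ => 1) x * weighted u (fun x => w x ^ 2) x =
      ∫ η, (fracSymbol a η : ℂ) *
        (𝓕 (weighted u fun _ => 1) η * 𝓕⁻ (weighted u fun x => w x ^ 2) η) := by
    rw [fracD_eq, ← SchwartzMap.fourier_coe,
      integral_fourierInv_mul (integrable_fracSymbol_mul ha _) (SchwartzMap.integrable _)]
    simp only [mul_assoc, SchwartzMap.fourierInv_coe]
  have h2 : ∫ x, ‖fracD (a / 2) (weighted u w) x‖ ^ 2 ≤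
      (∫ η, (fracSymbol a η : ℂ) * (𝓕 (weighted u w) η * 𝓕⁻ (weighted u w) η)).re := by
    refine (integral_norm_sq_fracD_le (by positivity) _).trans_eq ?_
    simp only [fourier_mul_fourierInv_weighted u hw, ← Complex.ofReal_mul, mul_pow,
      fracSymbol_half_sq]
    rw [integral_complex_ofReal, Complex.ofReal_re]
  have h3 : ∫ η, fracSymbol a η * (commDensity u w η).re =
      (∫ η, (fracSymbol a η : ℂ) * (𝓕 (weighted u w) η * 𝓕⁻ (weighted u w) η)).re -
      (∫ η, (fracSymbol a η : ℂ) *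
        (𝓕 (weighted u fun _ => 1) η * 𝓕⁻ (weighted u fun x => w x ^ 2) η)).re := by
    rw [← Complex.sub_re, ← integral_sub (hi _ _) (hi _ _)]
    have hI := integral_re (𝕜 := ℂ) ((hi (𝓕 (weighted u w)) (𝓕⁻ (weighted u w))).sub
      (hi (𝓕 (weighted u fun _ => 1)) (𝓕⁻ (weighted u fun x => w x ^ 2))))
    refine Eq.trans ?_ hI
    congr 1 with η
    rw [Pi.sub_apply, ← mul_sub]
    exact (Complex.re_ofReal_mul _ _).symm
  simp only [neg_mul]
  rw [integral_neg, h1, Complex.neg_re, h3]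
  linarith

end Main


/-- Lemma 4.3: weighted estimate
`∫(−|D|^α u) u φ' ≤ −∫(|D|^{α/2}(ϕu))² + C∫u²φ'` with `φ' = ⟨x⟩^{-2r}`, `ϕ = ⟨x⟩^{-r}`. -/
theorem stmt_11 (α r : ℝ) (hα1 : 1 ≤ α) (hα2 : α ≤ 2) (hr1 : 1 / 2 < r)
    (hr2 : r ≤ (α + 1) / 2) :
    ∃ C : ℝ, 0 < C ∧ ∀ u : SchwartzMap ℝ ℝ,
      (∫ x : ℝ, (-(fracD α (fun y => (u y : ℂ)) x)) * ((u x : ℝ) : ℂ)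
          * ((jap x ^ (-(2 * r)) : ℝ) : ℂ)).re
        ≤ - (∫ x : ℝ, ‖fracD (α / 2) (fun y => ((jap y ^ (-r) * u y : ℝ) : ℂ)) x‖ ^ 2)
          + C * ∫ x : ℝ, u x ^ 2 * jap x ^ (-(2 * r)) := by
  obtain ⟨C, hC, hle⟩ := exists_integral_fracSymbol_mul_commDensity_le (α := α) (r := r)
    (by linarith) hα2 hr1 (by linarith) (by linarith)
  refine ⟨C, hC, fun u => ?_⟩
  have hw := hasTemperateGrowth_weight r
  have hmain := re_integral_neg_fracD_mul_le u (a := α) (by linarith) hw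
  have hU : ⇑(weighted u fun _ => 1) = fun y => (u y : ℂ) := by
    ext x
    rw [weighted_apply u (.const 1), one_mul]
  have hV : ⇑(weighted u (weight r)) = fun y => ((jap y ^ (-r) * u y : ℝ) : ℂ) := by
    ext x
    rw [weighted_apply u hw, weight]
  have hW : ∀ x, weighted u (fun x => weight r x ^ 2) x =
      (u x : ℂ) * ((jap x ^ (-(2 * r)) : ℝ) : ℂ) := fun x => by
    rw [weighted_apply u (w := fun x => weight r x ^ 2) (hw.pow 2), weight_sq, Complex.ofReal_mul, mul_comm]
  have hN : ∀ x, u x ^ 2 * jap x ^ (-(2 * r)) = (weight r x * u x) ^ 2 := fun x => by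
    rw [← weight_sq, mul_pow, mul_comm]
  simp only [hU, hV, hW, ← mul_assoc] at hmain
  simp only [hN]
  linarith [hle u]
end
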